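/- arXiv:1506.09125 — 16 statements merged into one kernel-verified Lean document; each statement's English description precedes it below -/
import Mathlib

section
/- Let S be a Steiner loop with identity e, let G be a group, and let w : S ∖ {e} → G be a map such that w(x)² = 1 for every x ∈ S ∖ {e} and w(x)·w(y)·w(x) = w(x·y) for all distinct x, y ∈ S ∖ {e}. Then for all x, y ∈ S ∖ {e} one has (w(x)·w(y))³ = 1 and w(x)·w(y)·w(x) lies in the image of w; hence the image of w is a generating set of involutions of the subgroup of G it generates which satisfies the defining conditions of a restricted Fischer group. -/
/-- A weighted Steiner triple system (encoded by a Steiner loop `S` with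
identity `e` and a weight map `w : S ∖ {e} → G` consisting of involutions satisfying
`w(x)·w(y)·w(x) = w(x·y)` for distinct non-identity `x, y`) yields a set of involutions
`E = w '' (S ∖ {e})` satisfying the defining conditions of a restricted Fischer group:
every element of `E` is an involution and for all `a, b ∈ E` one has `(a·b)³ = 1` and
`a·b·a ∈ E`. -/
theorem stmt0 {S : Type*} [Mul S] (e : S)
    (hid : ∀ x : S, e * x = x)
    (hcomm : ∀ x y : S, x * y = y * x)
    (hss : ∀ x y : S, x * (x * y) = y)
    {G : Type*} [Group G] (w : S → G)
    (hinv : ∀ x : S, x ≠ e → (w x) ^ 2 = 1)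
    (hw : ∀ x y : S, x ≠ e → y ≠ e → x ≠ y → w x * w y * w x = w (x * y)) :
    (∀ a ∈ w '' {z : S | z ≠ e}, a ^ 2 = 1) ∧
    (∀ a ∈ w '' {z : S | z ≠ e}, ∀ b ∈ w '' {z : S | z ≠ e},
      (a * b) ^ 3 = 1 ∧ a * b * a ∈ w '' {z : S | z ≠ e}) := by
  have key : ∀ x y : S, x ≠ y → x * y ≠ e := by
    intro x y hxy h
    have h1 := hss x y
    rw [h, hcomm, hid] at h1
    exact hxy h1
  refine ⟨?_, ?_⟩
  · rintro _ ⟨x, hx, rfl⟩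
    exact hinv x hx
  · rintro _ ⟨x, hx, rfl⟩ _ ⟨y, hy, rfl⟩
    have hx2 : w x * w x = 1 := by rw [← pow_two]; exact hinv x hx
    by_cases hxy : x = y
    · subst hxy
      refine ⟨by rw [hx2, one_pow], x, hx, ?_⟩
      rw [hx2, one_mul]
    · have h1 := hw x y hx hy hxy
      have h2 := hw y x hy hx (Ne.symm hxy)
      rw [hcomm y x] at h2
      refine ⟨?_, x * y, key x y hxy, h1.symm⟩
      calc (w x * w y) ^ 3 = (w x * w y * w x) * (w y * w x * w y) := by
            simp only [pow_succ, pow_zero, one_mul, mul_assoc]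
        _ = 1 := by rw [h1, h2, ← pow_two]; exact hinv _ (key x y hxy)
end

section
/- Let S be a Steiner loop with identity e, let G be a group, and let w : S ∖ {e} → G be an injective map such that w(x)² = 1 for every x ∈ S ∖ {e}, w(x)·w(y)·w(x) = w(x·y) for all distinct x, y ∈ S ∖ {e}, and the subgroup of G generated by the image of w is non-abelian. Define a binary operation ∗ on S ∖ {e} by x ∗ y = x·y for x ≠ y and x ∗ x = x. Then (S ∖ {e}, ∗) is a distributive symmetric quasigroup, i.e. for all x, y, z ∈ S ∖ {e} one has x ∗ y = y ∗ x, x ∗ (x ∗ y) = y, and x ∗ (y ∗ z) = (x ∗ y) ∗ (x ∗ z). -/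
/-- If the weight map `w` of a weighted Steiner triple system is injective
(on `S ∖ {e}`) and the subgroup generated by its image is non-abelian, then the
operation `x ∗ y = x·y` for `x ≠ y`, `x ∗ x = x`, turns `S ∖ {e}` into a distributive
symmetric quasigroup. -/
theorem stmt1 {S : Type*} [Mul S] (e : S)
    (hid : ∀ x : S, e * x = x)
    (hcomm : ∀ x y : S, x * y = y * x)
    (hss : ∀ x y : S, x * (x * y) = y)
    {G : Type*} [Group G] (w : S → G)
    (hinv : ∀ x : S, x ≠ e → (w x) ^ 2 = 1)
    (hw : ∀ x y : S, x ≠ e → y ≠ e → x ≠ y → w x * w y * w x = w (x * y))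
    (hinj : ∀ x y : S, x ≠ e → y ≠ e → w x = w y → x = y)
    (hnab : ¬ ∀ a ∈ Subgroup.closure (w '' {z : S | z ≠ e}),
        ∀ b ∈ Subgroup.closure (w '' {z : S | z ≠ e}), a * b = b * a)
    (star : S → S → S)
    (hstar₁ : ∀ x y : S, x ≠ y → star x y = x * y)
    (hstar₂ : ∀ x : S, star x x = x) :
    ∀ x y z : S, x ≠ e → y ≠ e → z ≠ e →
      star x y = star y x ∧ star x (star x y) = y ∧
      star x (star y z) = star (star x y) (star x z) := by
  have hne : ∀ x y : S, x ≠ e → y ≠ e → star x y ≠ e := by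
    intro x y hx hy h
    by_cases hxy : x = y
    · subst hxy
      exact hx (by rw [← hstar₂ x, h])
    · rw [hstar₁ x y hxy] at h
      have h1 := hss x y
      rw [h, hcomm x e, hid] at h1
      exact hxy h1
  have hsq : ∀ x : S, x ≠ e → w x * w x = 1 := by
    intro x hx
    rw [← pow_two, hinv x hx]
  have hws : ∀ x y : S, x ≠ e → y ≠ e → w (star x y) = w x * w y * w x := by
    intro x y hx hy
    by_cases hxy : x = y
    · subst hxy
      rw [hstar₂, hsq x hx, one_mul]
    · rw [hstar₁ x y hxy, hw x y hx hy hxy]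
  intro x y z hx hy hz
  have hxy := hne x y hx hy
  have hxz := hne x z hx hz
  have hyz := hne y z hy hz
  have hc : ∀ g : G, w x * (w x * g) = g := by
    intro g
    rw [← mul_assoc, hsq x hx, one_mul]
  refine ⟨?_, ?_, ?_⟩
  · by_cases h : x = y
    · rw [h]
    · rw [hstar₁ x y h, hstar₁ y x (Ne.symm h), hcomm]
  · apply hinj _ _ (hne _ _ hx hxy) hy
    rw [hws _ _ hx hxy, hws _ _ hx hy]
    simp only [mul_assoc, hc, hsq x hx, mul_one]
  · apply hinj _ _ (hne _ _ hx hyz) (hne _ _ hxy hxz)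
    rw [hws _ _ hx hyz, hws _ _ hxy hxz, hws _ _ hx hy, hws _ _ hx hz, hws _ _ hy hz]
    simp only [mul_assoc, hc]
end

section
/- Let S be a Steiner loop with identity e, A a group, h : S ∖ {e} → A a map, and f : S × S → A a map with f(x,x) in the centre of A for every x ∈ S. Assume identity (∗): h(x)h(y)h(x)h(x·y) = f(x,x) for all distinct x, y ∈ S ∖ {e}. Then for every x ∈ S ∖ {e} the element h(x)² lies in the centre of the subgroup D of A generated by {h(z) : z ∈ S ∖ {e}}, i.e. h(x)² commutes with every element of D. -/
theorem aux_group {A : Type*} [Group A] (a b c p q r : A)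
    (hp : p ∈ Subgroup.center A) (hq : q ∈ Subgroup.center A) (hr : r ∈ Subgroup.center A)
    (h1 : a * b * a * c = p) (h2 : b * a * b * c = q) (h3 : c * a * c * b = r) :
    a ^ 2 * b = b * a ^ 2 := by
  obtain ⟨k, hk⟩ : ∃ k, k = q * p⁻¹ := ⟨_, rfl⟩
  have hkc : k ∈ Subgroup.center A := hk ▸ mul_mem hq (inv_mem hp)
  obtain ⟨D, hD⟩ : ∃ D, D = a * b * a := ⟨_, rfl⟩
  have kc : ∀ g, g * k = k * g := Subgroup.mem_center_iff.1 hkc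
  have pc : ∀ g, g * p = p * g := Subgroup.mem_center_iff.1 hp
  have hc : c = p * D⁻¹ := by
    rw [← pc, hD, ← h1]; group
  have hbab : b * a * b = k * D := by
    have : b * a * b = q * c⁻¹ := by rw [← h2]; group
    rw [this, hc, hk, ← pc]; group
  have e1 : D * b = k * (a * D) := by
    have : D * b = a * (b * a * b) := by rw [hD]; group
    rw [this, hbab, ← mul_assoc, kc, mul_assoc]
  have e2 : b * D = k * (D * a) := by
    have : b * D = (b * a * b) * a := by rw [hD]; group
    rw [this, hbab, mul_assoc]
  have hDD : D * D * b = b * (D * D) := by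
    rw [mul_assoc, e1, ← mul_assoc, kc, ← mul_assoc b, e2]; group
  have e3 : D⁻¹ * b = k * (a * D⁻¹) := by
    have : D⁻¹ * b = D⁻¹ * (b * D) * D⁻¹ := by group
    rw [this, e2, ← mul_assoc D⁻¹, kc]; group
  have h4 : p * p * k * (D⁻¹ * a * a * D⁻¹) = r := by
    rw [← h3, hc]
    have : p * D⁻¹ * a * (p * D⁻¹) * b = p * (D⁻¹ * a * p) * (D⁻¹ * b) := by group
    rw [this, pc (D⁻¹ * a), e3]
    have : p * (p * (D⁻¹ * a)) * (k * (a * D⁻¹)) = p * p * ((D⁻¹ * a) * k) * (a * D⁻¹) := by group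
    rw [this, kc (D⁻¹ * a)]; group
  obtain ⟨s, hs⟩ : ∃ s, s = (p * p * k)⁻¹ * r := ⟨_, rfl⟩
  have hsc : s ∈ Subgroup.center A :=
    hs ▸ mul_mem (inv_mem (mul_mem (mul_mem hp hp) hkc)) hr
  have sc : ∀ g, g * s = s * g := Subgroup.mem_center_iff.1 hsc
  have h5 : a ^ 2 = s * (D * D) := by
    have : a ^ 2 = D * ((p * p * k)⁻¹ * (p * p * k * (D⁻¹ * a * a * D⁻¹))) * D := by
      rw [pow_two]; group
    rw [this, h4, ← hs, sc, mul_assoc]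
  rw [h5, mul_assoc, hDD, ← mul_assoc b s, sc, mul_assoc s]


/-- (Lemma 5.2 a)) Under identity (∗): `h(x)h(y)h(x)h(x·y) = f(x,x)`
for distinct non-identity `x, y`, with all `f(x,x)` central in `A`, the squares
`h(x)²` are central in the subgroup `D` generated by the values of `h`. -/
theorem stmt3 {S : Type*} [Mul S] (e : S)
    (hid : ∀ x : S, e * x = x)
    (hcomm : ∀ x y : S, x * y = y * x)
    (hss : ∀ x y : S, x * (x * y) = y)
    {A : Type*} [Group A] (h : S → A) (f : S → S → A)
    (hfc : ∀ x : S, f x x ∈ Subgroup.center A)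
    (hstar : ∀ x y : S, x ≠ e → y ≠ e → x ≠ y →
      h x * h y * h x * h (x * y) = f x x) :
    ∀ x : S, x ≠ e → ∀ d ∈ Subgroup.closure (h '' {z : S | z ≠ e}),
      (h x) ^ 2 * d = d * (h x) ^ 2 := by
  have he : ∀ x : S, x * e = x := fun x => by rw [hcomm, hid]
  have hsq : ∀ x : S, x * x = e := fun x => by
    have := hss x e
    rwa [he] at this
  intro x hx d hd
  suffices d ∈ Subgroup.centralizer {(h x) ^ 2} from
    (Subgroup.mem_centralizer_singleton_iff.1 this).symm
  refine (Subgroup.closure_le _).2 ?_ hd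
  rintro _ ⟨y, hy, rfl⟩
  refine Subgroup.mem_centralizer_singleton_iff.2 ?_
  symm
  have hy' : y ≠ e := hy
  by_cases hxy : x = y
  · subst hxy
    group
  have hz : x * y ≠ e := fun H => by
    have := hss x y
    rw [H, he] at this
    exact hxy this
  have hzx : x * y ≠ x := fun H => by
    have := hss x y
    rw [H, hsq] at this
    exact hy' this.symm
  have h1 := hstar x y hx hy' hxy
  have h2 := hstar y x hy' hx (Ne.symm hxy)
  have h3 := hstar (x * y) x hz hx hzx
  rw [hcomm y x] at h2
  rw [hcomm (x * y) x, hss] at h3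
  exact aux_group _ _ _ _ _ _ (hfc _) (hfc _) (hfc _) h1 h2 h3
end

section
/- Let S be a Steiner loop with identity e, A a group, h : S ∖ {e} → A a map, and f : S × S → A a map with f(x,x) in the centre of A for every x ∈ S. Assume identity (∗): h(x)h(y)h(x)h(x·y) = f(x,x) for all distinct x, y ∈ S ∖ {e}. Let x, y ∈ S ∖ {e} be distinct and let H be the subgroup of A generated by {h(x), h(y), h(x·y)}, and let Z = H ∩ Z(D), where Z(D) is the centre of the subgroup D of A generated by {h(z) : z ∈ S ∖ {e}} (Z is central, hence normal, in H). Then either H is abelian, or the quotient group H/Z is isomorphic to the symmetric group on three letters; in particular, if H/Z is trivial or of order 2, then H is abelian. -/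
namespace Stmt4Aux

lemma rel_quot {Q : Type*} [Group Q] (a b c : Q) (h1 : a * b * a * c = 1)
    (h2 : b * a * b * c = 1) (h3 : c * a * c * b = 1) : b * b * (a * a) = 1 := by
  have e1 : c = (a * b * a)⁻¹ := (inv_eq_of_mul_eq_one_right h1).symm
  have e2 : a * b * a = b * a * b := mul_right_cancel (h1.trans h2.symm)
  have e3 : b = a * b * a * b * a := by
    rw [e1] at h3
    have : b = ((a * b * a)⁻¹ * a * (a * b * a)⁻¹)⁻¹ := (inv_eq_of_mul_eq_one_right h3).symm
    exact this.trans (by group)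
  rw [e2] at e3
  have e4 : a * b * b * a = 1 := by
    have : b * (a * b * b * a) = b * 1 := by
      rw [mul_one]; conv_rhs => rw [e3]
      group
    exact mul_left_cancel this
  calc b * b * (a * a) = a⁻¹ * (a * b * b * a) * a := by group
    _ = 1 := by rw [e4]; group

lemma sq_comm {A : Type*} [Group A] (a b c F1 F2 F3 : A)
    (c1 : F1 ∈ Subgroup.center A) (c2 : F2 ∈ Subgroup.center A) (c3 : F3 ∈ Subgroup.center A)
    (h1 : a * b * a * c = F1) (h2 : b * a * b * c = F2) (h3 : c * a * c * b = F3) :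
    (b * b) * a = a * (b * b) := by
  have m1 := h1.symm ▸ c1
  have m2 := h2.symm ▸ c2
  have m3 := h3.symm ▸ c3
  have key := rel_quot (Q := A ⧸ Subgroup.center A) a b c
    ((QuotientGroup.eq_one_iff _).2 (show _ ∈ Subgroup.center A from m1)) ((QuotientGroup.eq_one_iff _).2 (show _ ∈ Subgroup.center A from m2))
    ((QuotientGroup.eq_one_iff _).2 (show _ ∈ Subgroup.center A from m3))
  have key2 : b * b * (a * a) ∈ Subgroup.center A := (QuotientGroup.eq_one_iff _).1 key
  have := Subgroup.mem_center_iff.1 key2 a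
  apply mul_right_cancel (b := a * a)
  calc b * b * a * (a * a) = b * b * (a * a) * a := by group
    _ = _ := by rw [← this]; group

/-- the homomorphism from the dihedral group of order six -/
lemma exists_hom {Q : Type*} [Group Q] (a b : Q) (ha : a * a = 1) (hb : b * b = 1)
    (hab : a * b * a = b * a * b) :
    ∃ ψ : DihedralGroup 3 →* Q, ψ (.sr 0) = a ∧ ψ (.sr 1) = b ∧ (a ≠ b → Function.Injective ψ) := by
  have h3 : (a * b) ^ 3 = 1 := by
    calc (a * b) ^ 3 = (a * b * a) * (b * a * b) := by simp only [pow_succ, pow_zero, one_mul, mul_assoc]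
      _ = a * b * (a * a) * b * a := by rw [← hab]; group
      _ = a * (b * b) * a := by rw [ha]; group
      _ = 1 := by rw [hb, mul_one, ha]
  let g : Multiplicative (ZMod 3) →* Q := AddMonoidHom.toMultiplicativeLeft
    (ZMod.lift 3 ⟨(zmultiplesHom (Additive Q)) (Additive.ofMul (a * b)), by
      exact (natCast_zsmul (Additive.ofMul (a * b)) 3).trans (congrArg Additive.ofMul h3)⟩)
  have g1 : g (Multiplicative.ofAdd 1) = a * b := by
    have := ZMod.lift_coe 3 (A := Additive Q) ⟨(zmultiplesHom (Additive Q)) (Additive.ofMul (a * b)), by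
      exact (natCast_zsmul (Additive.ofMul (a * b)) 3).trans (congrArg Additive.ofMul h3)⟩ 1
    simp at this
    simp [g, this]
  have ai : a⁻¹ = a := inv_eq_of_mul_eq_one_right ha
  have bi : b⁻¹ = b := inv_eq_of_mul_eq_one_right hb
  let G : ZMod 3 → Q := fun i => g (Multiplicative.ofAdd i)
  have Gadd : ∀ i j, G (i + j) = G i * G j := fun i j => by simp [G]
  have G0 : G 0 = 1 := by simp [G]
  have G1 : G 1 = a * b := g1
  have G2 : G 2 = a * b * (a * b) := by
    rw [show (2 : ZMod 3) = 1 + 1 by decide, Gadd, G1]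
  have Gconj : ∀ i, G i * a = a * G (-i) := by
    intro i
    fin_cases i
    · change G 0 * a = a * G 0; simp [G0]
    · change G 1 * a = a * G 2
      rw [G1, G2]
      calc a * b * a = (b * a * b) := hab
        _ = (a * a) * (b * a * b) := by rw [ha, one_mul]
        _ = _ := by group
    · change G 2 * a = a * G 1
      rw [G1, G2]
      calc a * b * (a * b) * a = a * b * (a * b * a) := by group
        _ = a * (b * b) * a * b := by rw [hab]; group
        _ = _ := by rw [hb]; group
  let ψ : DihedralGroup 3 →* Q :=
    { toFun := fun d => match d with
        | .r i => G i
        | .sr i => a * G i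
      map_one' := G0
      map_mul' := by
        rintro (i | i) (j | j)
        · exact Gadd i j
        · change a * G (j - i) = G i * (a * G j)
          rw [← mul_assoc, Gconj, mul_assoc, ← Gadd, neg_add_eq_sub]
        · change a * G (i + j) = a * G i * G j
          rw [Gadd, mul_assoc]
        · change G (j - i) = a * G i * (a * G j)
          rw [mul_assoc, ← mul_assoc (G i), Gconj, mul_assoc, ← mul_assoc, ha, one_mul, ← Gadd,
            neg_add_eq_sub] }
  refine ⟨ψ, ?_, ?_, ?_⟩
  · change a * G 0 = a
    simp [G0]
  · change a * G 1 = b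
    rw [G1, ← mul_assoc, ha, one_mul]
  · intro hne
    have hb1 : b ≠ 1 := by
      rintro rfl
      simp [ha] at hab
      exact hne hab.symm
    have ha1 : a ≠ 1 := by
      rintro rfl
      simp [hb] at hab
      exact hne hab.symm
    rw [injective_iff_map_eq_one]
    rintro (i | i) hi
    · change G i = 1 at hi
      fin_cases i
      · rfl
      · change G 1 = 1 at hi
        rw [G1] at hi
        exact absurd (by rw [← ai]; exact inv_eq_of_mul_eq_one_right hi) hne
      · change G 2 = 1 at hi
        rw [G2] at hi
        have : a * b = 1 := by
          calc a * b = (a * b * (a * b)) * (a * b) := by rw [hi, one_mul]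
            _ = 1 := by rw [← h3]; simp only [pow_succ, pow_zero, one_mul, mul_assoc]
        exact absurd (by rw [← ai]; exact inv_eq_of_mul_eq_one_right this) hne
    · exfalso
      change a * G i = 1 at hi
      fin_cases i
      · change a * G 0 = 1 at hi
        exact ha1 (by simpa [G0] using hi)
      · change a * G 1 = 1 at hi
        rw [G1, ← mul_assoc, ha, one_mul] at hi
        exact hb1 hi
      · change a * G 2 = 1 at hi
        rw [G2] at hi
        have : a = 1 := by
          calc a = (b * b) * a * (b * b) := by rw [hb]; group
            _ = b * ((a * a) * b * a * b) * b := by rw [ha]; group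
            _ = b * (a * (a * b * (a * b))) * b := by group
            _ = 1 := by rw [hi, mul_one, hb]
        exact ha1 this

lemma dihedral_perm : Nonempty (DihedralGroup 3 ≃* Equiv.Perm (Fin 3)) := by
  obtain ⟨ψ, -, -, hi⟩ := exists_hom (Q := Equiv.Perm (Fin 3)) (Equiv.swap 0 1) (Equiv.swap 1 2)
    (by decide) (by decide) (by decide)
  have hi := hi (by decide)
  refine ⟨MulEquiv.ofBijective ψ ((Fintype.bijective_iff_injective_and_card ψ).2 ⟨hi, ?_⟩)⟩
  rw [DihedralGroup.card, Fintype.card_perm]; rfl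

lemma comm_closure {A : Type*} [Group A] (a b c : A) (h1 : a * b = b * a) (h2 : a * c = c * a)
    (h3 : b * c = c * b) : ∀ u ∈ Subgroup.closure {a, b, c}, ∀ v ∈ Subgroup.closure {a, b, c},
      u * v = v * u := by
  have := Subgroup.isMulCommutative_closure (k := {a, b, c}) (by
    rintro x (rfl | rfl | rfl) y (rfl | rfl | rfl) <;> simp_all)
  intro u hu v hv
  exact congrArg Subtype.val (this.is_comm.comm ⟨u, hu⟩ ⟨v, hv⟩)

end Stmt4Aux

/-- (Lemma 5.2 b)(i)) Under identity (∗), for a block `{x, y, x·y}` the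
group `H = ⟨h(x), h(y), h(x·y)⟩` is either abelian or `H/Z ≅ S₃` where
`Z = H ∩ Z(D)`; and if `H/Z` is trivial or of order `2`, then `H` is abelian. -/
theorem stmt4 {S : Type*} [Mul S] (e : S)
    (hid : ∀ x : S, e * x = x)
    (hcomm : ∀ x y : S, x * y = y * x)
    (hss : ∀ x y : S, x * (x * y) = y)
    {A : Type*} [Group A] (h : S → A) (f : S → S → A)
    (hfc : ∀ x : S, f x x ∈ Subgroup.center A)
    (hstar : ∀ x y : S, x ≠ e → y ≠ e → x ≠ y →
      h x * h y * h x * h (x * y) = f x x)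
    (x y : S) (hx : x ≠ e) (hy : y ≠ e) (hxy : x ≠ y) :
    let D : Subgroup A := Subgroup.closure (h '' {z : S | z ≠ e})
    let ZD : Subgroup A := D ⊓ Subgroup.centralizer (D : Set A)
    let H : Subgroup A := Subgroup.closure {h x, h y, h (x * y)}
    let Z : Subgroup A := H ⊓ ZD
    ((∀ a ∈ H, ∀ b ∈ H, a * b = b * a) ∨
      ∃ φ : H →* Equiv.Perm (Fin 3),
        Function.Surjective φ ∧ φ.ker = Z.subgroupOf H) ∧
    ((Z.subgroupOf H).index = 1 ∨ (Z.subgroupOf H).index = 2 →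
      ∀ a ∈ H, ∀ b ∈ H, a * b = b * a) := by
  intro D ZD H Z
  have hxe : ∀ u : S, u * e = u := fun u => by rw [hcomm, hid]
  have hsq : ∀ u : S, u * u = e := fun u => by
    have := hss u e
    rwa [hxe] at this
  have pe : ∀ u v : S, u ≠ v → u * v ≠ e := fun u v huv h0 => by
    have := hss u v
    rw [h0, hxe] at this
    exact huv this
  have pl : ∀ u v : S, v ≠ e → u * v ≠ u := fun u v hv h0 => by
    have := hss u v
    rw [h0, hsq] at this
    exact hv this.symm
  have pr : ∀ u v : S, u ≠ e → u * v ≠ v := fun u v hu => by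
    rw [hcomm]; exact pl v u hu
  have hD : ∀ z, z ≠ e → h z ∈ D := fun z hz => Subgroup.subset_closure ⟨z, hz, rfl⟩
  have e3 : ∀ u v : S, u ≠ e → v ≠ e → u ≠ v →
      h (u * v) * h u * h (u * v) * h v = f (u * v) (u * v) := fun u v hu hv huv => by
    have := hstar (u * v) u (pe u v huv) hu (pl u v hv)
    rwa [hcomm (u * v) u, hss] at this
  have e2 : ∀ u v : S, u ≠ e → v ≠ e → u ≠ v →
      h v * h u * h v * h (u * v) = f v v := fun u v hu hv huv => by
    have := hstar v u hv hu huv.symm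
    rwa [hcomm v u] at this
  have hsqZ : ∀ z, z ≠ e → h z * h z ∈ ZD := by
    intro z hz
    refine ⟨D.mul_mem (hD z hz) (hD z hz), ?_⟩
    have hle : D ≤ Subgroup.centralizer {h z * h z} := by
      refine (Subgroup.closure_le _).2 ?_
      rintro _ ⟨w, hw, rfl⟩
      rw [SetLike.mem_coe, Subgroup.mem_centralizer_singleton_iff]
      by_cases hwz : w = z
      · subst hwz; group
      · exact (Stmt4Aux.sq_comm _ _ _ _ _ _ (hfc _) (hfc _) (hfc _) (hstar w z hw hz hwz)
          (e2 w z hw hz hwz) (e3 w z hw hz hwz)).symm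
    refine Subgroup.mem_centralizer_iff.2 ?_
    intro d hd
    exact Subgroup.mem_centralizer_singleton_iff.1 (hle hd)
  have hcen : ∀ d ∈ D, d ∈ Subgroup.center A → d ∈ ZD := fun d hd hc =>
    ⟨hd, Subgroup.center_le_centralizer _ hc⟩
  have haD := hD x hx
  have hbD := hD y hy
  have hcD := hD _ (pe x y hxy)
  have s1 := hstar x y hx hy hxy
  have s2 := e2 x y hx hy hxy
  have haZ := hsqZ x hx
  have hbZ := hsqZ y hy
  have z1 := hcen (h x * h y * h x * h (x * y)) (D.mul_mem (D.mul_mem (D.mul_mem haD hbD) haD) hcD) (s1 ▸ hfc x)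
  have z2 := hcen (h y * h x * h y * h (x * y)) (D.mul_mem (D.mul_mem (D.mul_mem hbD haD) hbD) hcD) (s2 ▸ hfc y)
  have haH : h x ∈ H := Subgroup.subset_closure (by simp)
  have hbH : h y ∈ H := Subgroup.subset_closure (by simp)
  have hcH : h (x * y) ∈ H := Subgroup.subset_closure (by simp)
  have hHD : H ≤ D := (Subgroup.closure_le _).2 (by
    rintro _ (rfl | rfl | rfl)
    exacts [haD, hbD, hcD])
  have hN : (Z.subgroupOf H).Normal := by
    constructor
    intro n hn g
    have hc : (g : A) * n = n * g := hn.2.2 g (hHD g.2)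
    have : g * n * g⁻¹ = n := by
      apply Subtype.ext
      simp [hc]
    rwa [this]
  have main : (∀ a ∈ H, ∀ b ∈ H, a * b = b * a) ∨
      ∃ φ : H →* Equiv.Perm (Fin 3),
        Function.Surjective φ ∧ φ.ker = Z.subgroupOf H := by
    let q := QuotientGroup.mk' (Z.subgroupOf H)
    let a : H := ⟨h x, haH⟩
    let b : H := ⟨h y, hbH⟩
    let c : H := ⟨h (x * y), hcH⟩
    have hq : ∀ u : H, (u : A) ∈ ZD → q u = 1 := fun u hu =>
      (QuotientGroup.eq_one_iff u).2 ⟨u.2, hu⟩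
    have qa : q a * q a = 1 := by rw [← map_mul]; exact hq _ haZ
    have qb : q b * q b = 1 := by rw [← map_mul]; exact hq _ hbZ
    have q1 : q a * q b * q a * q c = 1 := by simp only [← map_mul]; exact hq _ z1
    have q2 : q b * q a * q b * q c = 1 := by simp only [← map_mul]; exact hq _ z2
    have hab : q a * q b * q a = q b * q a * q b := mul_right_cancel (q1.trans q2.symm)
    by_cases hne : q a = q b
    · left
      have hm : a⁻¹ * b ∈ Z.subgroupOf H := QuotientGroup.eq.1 hne
      have hz : h x * ((h x)⁻¹ * h y) = ((h x)⁻¹ * h y) * h x := hm.2.2 _ haD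
      have cab : h x * h y = h y * h x := by
        calc h x * h y = h x * (h x * ((h x)⁻¹ * h y)) := by group
          _ = _ := by rw [hz]; group
      have hcom : Commute (h x) (h y) := cab
      have hc : h (x * y) = (h x * h y * h x)⁻¹ * f x x := by rw [← s1]; group
      have hF : ∀ g, Commute g (f x x) := fun g => Subgroup.mem_center_iff.1 (hfc x) g
      refine Stmt4Aux.comm_closure _ _ _ cab ?_ ?_
      · rw [hc]
        exact ((((Commute.refl _).mul_right hcom).mul_right (Commute.refl _)).inv_right).mul_right (hF _)
      · rw [hc]
        exact (((hcom.symm.mul_right (Commute.refl _)).mul_right hcom.symm).inv_right).mul_right (hF _)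
    · right
      obtain ⟨ψ, p0, p1, hinj⟩ := Stmt4Aux.exists_hom (q a) (q b) qa qb hab
      have hsurj : Function.Surjective ψ := by
        have ra : q a ∈ ψ.range := ⟨_, p0⟩
        have rb : q b ∈ ψ.range := ⟨_, p1⟩
        have rc : q c ∈ ψ.range := by
          rw [← inv_eq_of_mul_eq_one_right q1]
          exact inv_mem (mul_mem (mul_mem ra rb) ra)
        have hle : H ≤ (ψ.range.comap q).map H.subtype := by
          refine (Subgroup.closure_le _).2 ?_
          rintro _ (rfl | rfl | rfl)
          exacts [⟨a, ra, rfl⟩, ⟨b, rb, rfl⟩, ⟨c, rc, rfl⟩]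
        intro t
        obtain ⟨u, rfl⟩ := QuotientGroup.mk'_surjective _ t
        obtain ⟨v, hv, hvu⟩ := hle u.2
        have : v = u := Subtype.ext hvu
        subst this
        exact hv
      obtain ⟨E⟩ := Stmt4Aux.dihedral_perm
      let E' := MulEquiv.ofBijective ψ ⟨hinj hne, hsurj⟩
      refine ⟨((E'.symm.trans E).toMonoidHom).comp q,
        (E'.symm.trans E).surjective.comp (QuotientGroup.mk'_surjective _), ?_⟩
      ext u
      rw [MonoidHom.mem_ker]
      change (E'.symm.trans E) (q u) = 1 ↔ _
      rw [EmbeddingLike.map_eq_one_iff]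
      exact QuotientGroup.eq_one_iff u
  refine ⟨main, fun hi => main.elim id ?_⟩
  rintro ⟨φ, hs, hk⟩
  exfalso
  rw [← hk, Subgroup.index_ker, MonoidHom.range_eq_top.2 hs, Subgroup.card_top,
    Nat.card_eq_fintype_card, Fintype.card_perm] at hi
  revert hi
  decide
end

section
/- Let S = {e, x, y, x·y} be a Steiner loop with exactly four elements (so S is the elementary abelian group of order 4), let A be a group, h : S ∖ {e} → A a map, and f : S × S → A a map with f(z,z) in the centre of A for every z ∈ S. Assume identity (∗): h(u)h(v)h(u)h(u·v) = f(u,u) for all distinct u, v ∈ S ∖ {e}, and assume that the subgroup D of A generated by {h(x), h(y), h(x·y)} is non-abelian. Then the commutator subgroup D′ of D is cyclic of order 3, the intersection of D′ with the centre Z(D) of D is trivial, and the subgroup of D generated by D′ and Z(D) has index 2 in D. -/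
section Core

open scoped commutatorElement

variable {A : Type*} [Group A]

/-- Elements conjugating `t` to `t` or `t⁻¹`. -/
def invStab (t : A) : Subgroup A where
  carrier := {d | d * t * d⁻¹ = t ∨ d * t * d⁻¹ = t⁻¹}
  one_mem' := by simp
  mul_mem' := by
    intro g k hg hk
    have e1 : g * k * t * (g * k)⁻¹ = g * (k * t * k⁻¹) * g⁻¹ := by group
    have e2 : g * t⁻¹ * g⁻¹ = (g * t * g⁻¹)⁻¹ := by group
    simp only [Set.mem_ofPred_eq] at *
    rw [e1]
    rcases hk with hk | hk <;> rw [hk]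
    · exact hg
    · rw [e2]
      rcases hg with hg | hg <;> rw [hg] <;> simp
  inv_mem' := by
    intro g hg
    simp only [Set.mem_ofPred_eq] at *
    rcases hg with hg | hg
    · left
      nth_rw 1 [← hg]
      group
    · right
      have : t = (g * t * g⁻¹)⁻¹ := by rw [hg]; simp
      nth_rw 1 [this]
      group

theorem invStab_conj {t d s : A} (hd : d ∈ invStab t) (hs : s ∈ Subgroup.zpowers t) :
    d * s * d⁻¹ ∈ Subgroup.zpowers t := by
  obtain ⟨n, rfl⟩ := hs
  simp only [← conj_zpow]
  rcases hd with hd | hd <;> rw [hd]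
  · exact ⟨n, rfl⟩
  · exact ⟨-n, by simp⟩

/-- Elements normalising `t` whose commutator with `k` lies in the subgroup of `t`. -/
def commStab (t k : A) : Subgroup A where
  carrier := {g | g ∈ invStab t ∧ ⁅g, k⁆ ∈ Subgroup.zpowers t}
  one_mem' := ⟨one_mem _, by simp [commutatorElement_def]⟩
  mul_mem' := by
    rintro g l ⟨hg, hg'⟩ ⟨hl, hl'⟩
    refine ⟨mul_mem hg hl, ?_⟩
    have : ⁅g * l, k⁆ = g * ⁅l, k⁆ * g⁻¹ * ⁅g, k⁆ := by
      simp only [commutatorElement_def]; group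
    rw [this]
    exact mul_mem (invStab_conj hg hl') hg'
  inv_mem' := by
    rintro g ⟨hg, hg'⟩
    refine ⟨inv_mem hg, ?_⟩
    have : ⁅g⁻¹, k⁆ = g⁻¹ * ⁅g, k⁆⁻¹ * g⁻¹⁻¹ := by
      simp only [commutatorElement_def]; group
    rw [this]
    exact invStab_conj (inv_mem hg) (inv_mem hg')

theorem core (a b c p q r : A) (hp : p ∈ Subgroup.center A) (hq : q ∈ Subgroup.center A)
    (hr : r ∈ Subgroup.center A) (h1 : a * b * a * c = p) (h2 : b * a * b * c = q)
    (h3 : c * a * c * b = r)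
    (hnab : ¬ ∀ g ∈ Subgroup.closure ({a, b, c} : Set A),
        ∀ k ∈ Subgroup.closure ({a, b, c} : Set A), g * k = k * g) :
    let D : Subgroup A := Subgroup.closure {a, b, c}
    let D' : Subgroup A := ⁅D, D⁆
    let ZD : Subgroup A := D ⊓ Subgroup.centralizer (D : Set A)
    IsCyclic D' ∧ Nat.card D' = 3 ∧ D' ⊓ ZD = ⊥ ∧
      ((D' ⊔ ZD).subgroupOf D).index = 2 := by
  intro D D' ZD
  have haD : a ∈ D := Subgroup.subset_closure (by simp)
  have hbD : b ∈ D := Subgroup.subset_closure (by simp)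
  have hcD : c ∈ D := Subgroup.subset_closure (by simp)
  have hc : c = p * (a * b * a)⁻¹ := by
    rw [← (Subgroup.mem_center_iff.1 hp), ← h1]; group
  have key : ∀ K : Subgroup A, Subgroup.center A ≤ K → a ∈ K → b ∈ K → D ≤ K := by
    intro K hK ha hb
    refine (Subgroup.closure_le K).2 ?_
    rintro g (rfl | rfl | rfl)
    · exact ha
    · exact hb
    · show _ ∈ K
      rw [hc]
      exact mul_mem (hK hp) (inv_mem (mul_mem (mul_mem ha hb) ha))
  -- the central element z
  obtain ⟨z, hz⟩ : ∃ z, z = p * q⁻¹ := ⟨_, rfl⟩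
  have hzc : z ∈ Subgroup.center A := hz ▸ mul_mem hp (inv_mem hq)
  have zc : ∀ g, g * z = z * g := Subgroup.mem_center_iff.1 hzc
  have hpD : p ∈ D := h1 ▸ mul_mem (mul_mem (mul_mem haD hbD) haD) hcD
  have hqD : q ∈ D := h2 ▸ mul_mem (mul_mem (mul_mem hbD haD) hbD) hcD
  have hzD : z ∈ D := hz ▸ mul_mem hpD (inv_mem hqD)
  have braid : a * b * a = z * (b * a * b) := by
    have h5 : a * b * a * c = z * (b * a * b) * c := by
      rw [h1, mul_assoc, h2, hz]; group
    exact mul_right_cancel h5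
  -- abba is central
  obtain ⟨w, hw⟩ : ∃ w, w = p * p * r⁻¹ * z⁻¹ := ⟨_, rfl⟩
  have hwc : w ∈ Subgroup.center A :=
    hw ▸ mul_mem (mul_mem (mul_mem hp hp) (inv_mem hr)) (inv_mem hzc)
  have wc : ∀ g, g * w = w * g := Subgroup.mem_center_iff.1 hwc
  have pc : ∀ g, g * p = p * g := Subgroup.mem_center_iff.1 hp
  have e1 : a * b * (a * b * a) * r = p * p * b := by
    rw [← h3, hc]
    calc a * b * (a * b * a) * (p * (a * b * a)⁻¹ * a * (p * (a * b * a)⁻¹) * b)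
        = (a * b * (a * b * a) * p) * ((a * b * a)⁻¹ * a * p) * ((a * b * a)⁻¹ * b) := by group
      _ = (p * (a * b * (a * b * a))) * (p * ((a * b * a)⁻¹ * a)) * ((a * b * a)⁻¹ * b) := by
          rw [pc, pc ((a * b * a)⁻¹ * a)]
      _ = p * ((a * b * (a * b * a)) * p) * (((a * b * a)⁻¹ * a) * ((a * b * a)⁻¹ * b)) := by group
      _ = p * (p * (a * b * (a * b * a))) * (((a * b * a)⁻¹ * a) * ((a * b * a)⁻¹ * b)) := by
          rw [pc]
      _ = p * p * b := by group
  have abba : a * b * b * a = w := by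
    have e2 : a * b * (a * b * a) = z * b * (a * b * b * a) := by
      calc a * b * (a * b * a) = (a * b * a) * b * a := by group
        _ = _ := by rw [braid]; group
    rw [e2] at e1
    have e3 : z * b * (a * b * b * a) = p * p * b * r⁻¹ := by rw [← e1]; group
    have rc : r⁻¹ * b = b * r⁻¹ := ((Subgroup.mem_center_iff.1 (inv_mem hr)) b).symm
    have zic : ∀ g, g * z⁻¹ = z⁻¹ * g := Subgroup.mem_center_iff.1 (inv_mem hzc)
    have ppc : ∀ g, g * (p * p) = p * p * g := Subgroup.mem_center_iff.1 (mul_mem hp hp)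
    calc a * b * b * a = (z * b)⁻¹ * (z * b * (a * b * b * a)) := by group
      _ = b⁻¹ * (z⁻¹ * (p * p * b * r⁻¹)) := by rw [e3]; group
      _ = b⁻¹ * ((b * (p * p)) * r⁻¹ * z⁻¹) := by rw [ppc b, zic]
      _ = w := by rw [hw]; group
  have aabb : a * a * (b * b) = w := by
    calc a * a * (b * b) = a * (a * b * b * a) * a⁻¹ := by group
      _ = w := by rw [abba, wc]; group
  have hbb : b * b = w * (a * a)⁻¹ := by rw [← wc, ← aabb]; group
  have haa : a * a = w * (b * b)⁻¹ := by rw [← aabb]; group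
  have aac : ∀ d ∈ D, d * (a * a) = a * a * d := by
    have : D ≤ Subgroup.centralizer {a * a} := by
      apply key
      · exact Subgroup.center_le_centralizer _
      · rw [Subgroup.mem_centralizer_singleton_iff]; group
      · rw [Subgroup.mem_centralizer_singleton_iff, haa]
        calc b * (w * (b * b)⁻¹) = (b * w) * (b * b)⁻¹ := by group
          _ = _ := by rw [wc]; group
    intro d hd
    exact (Subgroup.mem_centralizer_singleton_iff.1 (this hd))
  have haaZ : a * a ∈ ZD :=
    ⟨mul_mem haD haD, Subgroup.mem_centralizer_iff.2 fun d hd => aac d hd⟩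
  have cenZ : ∀ g ∈ D, g ∈ Subgroup.center A → g ∈ ZD := fun g hg hg' =>
    ⟨hg, Subgroup.center_le_centralizer _ hg'⟩
  have aazbb : a * a = (z * b) * (z * b) := by
    have : (a * a) * (a * b) = (z * b) * (z * b) * (a * b) := by
      calc (a * a) * (a * b) = a * b * (a * a) := (aac _ (mul_mem haD hbD)).symm
        _ = (a * b * a) * a := by group
        _ = (z * b) * (a * b * a) := by nth_rw 1 [braid]; group
        _ = (z * b) * (z * b) * (a * b) := by rw [braid]; group
    exact mul_right_cancel this
  -- the generator t
  obtain ⟨t, ht⟩ : ∃ t, t = z * b * a⁻¹ := ⟨_, rfl⟩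
  have htD : t ∈ D := ht ▸ mul_mem (mul_mem hzD hbD) (inv_mem haD)
  have hta : t * a = z * b := by rw [ht]; group
  have hb : b = z⁻¹ * (t * a) := by rw [hta]; group
  have tat : t * a * t = a := by
    rw [hta]
    calc z * b * t = (z * b) * (z * b) * a⁻¹ := by rw [ht]; group
      _ = a := by rw [← aazbb]; group
  have att : a * t = t * t * a := by
    have : a * t * (a * a) = t * t * a * (a * a) := by
      calc a * t * (a * a) = a * (t * a) * a := by group
        _ = (a * z) * b * a := by rw [hta]; group
        _ = z * (a * b * a) := by rw [zc]; group
        _ = z * (z * b) * a * b := by rw [braid]; group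
        _ = (z * (t * a)) * (a * b) := by rw [hta]; group
        _ = ((t * a) * z) * (a * b) := by rw [zc]
        _ = t * a * (z * a) * b := by group
        _ = t * a * (a * z) * b := by rw [zc]
        _ = t * a * a * (z * b) := by group
        _ = t * ((a * a) * t) * a := by rw [← hta]; group
        _ = t * (t * (a * a)) * a := by rw [aac t htD]
        _ = _ := by group
    exact mul_right_cancel this
  have t3 : t * t * t = 1 := by
    have : t * t * t * a = a := by
      calc t * t * t * a = t * (t * t * a) := by group
        _ = t * a * t := by rw [← att]; group
        _ = a := tat
    exact mul_eq_right.1 this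
  have cata : a * t * a⁻¹ = t⁻¹ := by
    rw [att]
    calc t * t * a * a⁻¹ = (t * t * t) * t⁻¹ := by group
      _ = _ := by rw [t3]; simp
  have hN : D ≤ invStab t := by
    apply key
    · intro g hg
      left
      rw [← Subgroup.mem_center_iff.1 hg]; group
    · exact Or.inr cata
    · have hz' : z⁻¹ ∈ invStab t := by
        left
        rw [← Subgroup.mem_center_iff.1 (inv_mem hzc)]; group
      rw [hb]
      refine mul_mem hz' (mul_mem ?_ (Or.inr cata))
      left; group
  have hab : ⁅a, b⁆ = t := by
    have : a * b = t * (b * a) := by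
      have h5 : z * (a * b) = z * (t * (b * a)) := by
        calc z * (a * b) = (a * z) * b := by rw [zc]; group
          _ = a * t * a := by rw [← mul_assoc a t a |>.symm, hta]; group
          _ = t * (t * a) * a := by rw [att]; group
          _ = (t * z) * (b * a) := by rw [hta]; group
          _ = _ := by rw [zc]; group
      exact mul_left_cancel h5
    rw [commutatorElement_def, this]; group
  have hT : t ∈ Subgroup.zpowers t := Subgroup.mem_zpowers t
  have cst : ∀ k, Subgroup.center A ≤ commStab t k := by
    intro k g hg
    refine ⟨Or.inl ?_, ?_⟩
    · rw [← Subgroup.mem_center_iff.1 hg]; group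
    · have : ⁅g, k⁆ = 1 := by
        rw [commutatorElement_def, ← Subgroup.mem_center_iff.1 hg]; group
      rw [this]; exact one_mem _
  have hDb : D ≤ commStab t b := by
    apply key _ (cst b)
    · exact ⟨hN haD, hab ▸ hT⟩
    · exact ⟨hN hbD, by simp [commutatorElement_self]⟩
  have hDa : D ≤ commStab t a := by
    apply key _ (cst a)
    · exact ⟨hN haD, by simp [commutatorElement_self]⟩
    · exact ⟨hN hbD, by rw [← commutatorElement_inv, hab]; exact inv_mem hT⟩
  have hDk : ∀ k ∈ D, D ≤ commStab t k := by
    intro k hk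
    apply key _ (cst k)
    · exact ⟨hN haD, by rw [← commutatorElement_inv]; exact inv_mem (hDa hk).2⟩
    · exact ⟨hN hbD, by rw [← commutatorElement_inv]; exact inv_mem (hDb hk).2⟩
  have hD' : D' = Subgroup.zpowers t := by
    apply le_antisymm
    · exact Subgroup.commutator_le.2 fun g hg k hk => (hDk k hk hg).2
    · rw [Subgroup.zpowers_le, ← hab]
      exact Subgroup.commutator_mem_commutator haD hbD
  have ht1 : t ≠ 1 := by
    intro h0
    apply hnab
    intro g hg k hk
    have := (hDk k hk hg).2
    rw [h0, Subgroup.zpowers_one_eq_bot, Subgroup.mem_bot] at this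
    exact commutatorElement_eq_one_iff_mul_comm.1 this
  have hord : orderOf t = 3 := by
    apply orderOf_eq_prime _ ht1
    rw [← t3, pow_succ, pow_two]
  have hZt : ∀ g ∈ ZD, g * t = t * g := fun g hg =>
    ((Subgroup.mem_centralizer_iff.1 hg.2) t htD).symm
  have hant : a * t ≠ t * a := by
    intro h0
    rw [att] at h0
    exact ht1 (mul_eq_left.1 (mul_right_cancel h0))
  refine ⟨?_, ?_, ?_, ?_⟩
  · rw [hD']; infer_instance
  · rw [hD', Nat.card_zpowers, hord]
  · rw [hD', eq_bot_iff]
    rintro g ⟨⟨n, hn⟩, hgZ⟩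
    have hga : a * g = g * a := (Subgroup.mem_centralizer_iff.1 hgZ.2) a haD
    have h6 : a * g * a⁻¹ = g⁻¹ := by
      rw [← hn]
      simp only [← conj_zpow]
      rw [cata]; simp
    have h7 : g = g⁻¹ := by rw [← h6, hga]; group
    have h8 : g * g = 1 := by nth_rw 2 [h7]; simp
    have h9 : g * g * g = 1 := by
      rw [← hn]
      calc t ^ n * t ^ n * t ^ n = (t * t * t) ^ n := by
            have : t * t * t = t ^ (3:ℤ) := by
              rw [← pow_two, ← pow_succ]; exact (zpow_natCast t 3).symm
            rw [this, ← zpow_mul, ← zpow_add, ← zpow_add]; congr 1; ring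
        _ = 1 := by rw [t3]; simp
    rw [h8, one_mul] at h9
    simpa using h9
  · obtain ⟨H, hH⟩ : ∃ H, H = D' ⊔ ZD := ⟨_, rfl⟩
    rw [← hH]
    have hZH : ZD ≤ H := hH ▸ le_sup_right
    have hDH : D' ≤ H := hH ▸ le_sup_left
    have htH : t ∈ H := hDH (hD' ▸ hT)
    have haH : a ∉ H := by
      intro h0
      have : H ≤ Subgroup.centralizer {t} := by
        rw [hH, hD']
        refine sup_le ?_ ?_
        · rw [Subgroup.zpowers_le, Subgroup.mem_centralizer_singleton_iff]
        · intro g hg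
          rw [Subgroup.mem_centralizer_singleton_iff]
          exact hZt g hg
      exact hant (Subgroup.mem_centralizer_singleton_iff.1 (this h0))
    have sw : ∀ g ∈ D, ∀ k ∈ D, g * k ∈ H → k * g ∈ H := by
      intro g hg k hk hgk
      have : k * g = ⁅k, g⁆ * (g * k) := by rw [commutatorElement_def]; group
      rw [this]
      exact mul_mem (hDH (Subgroup.commutator_mem_commutator hk hg)) hgk
    have haaH := hZH haaZ
    have hba : b * a ∈ H := by
      have : b * a = z⁻¹ * (t * (a * a)) := by rw [hb]; group
      rw [this]
      exact mul_mem (inv_mem (hZH (cenZ z hzD hzc))) (mul_mem htH haaH)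
    have tot : ∀ d ∈ D, d ∈ H ∨ d * a ∈ H := by
      intro d hd
      induction hd using Subgroup.closure_induction with
      | mem g hg =>
        right
        rcases hg with hg | hg | hg <;> rw [hg]
        · exact haaH
        · exact hba
        · have : c * a = p * (b * a)⁻¹ := by rw [hc]; group
          rw [this]
          exact mul_mem (hZH (cenZ p hpD hp)) (inv_mem hba)
      | one => left; exact one_mem _
      | mul g k hg hk ihg ihk =>
        rcases ihg with ihg | ihg <;> rcases ihk with ihk | ihk
        · left; exact mul_mem ihg ihk
        · right; rw [mul_assoc]; exact mul_mem ihg ihk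
        · right
          refine sw _ haD _ (mul_mem hg hk) ?_
          rw [← mul_assoc]
          exact mul_mem (sw _ hg _ haD ihg) ihk
        · left
          have : g * k = (g * a) * (a * a)⁻¹ * (a * k) := by group
          rw [this]
          exact mul_mem (mul_mem ihg (inv_mem haaH)) (sw _ hk _ haD ihk)
      | inv g hg ihg =>
        rcases ihg with ihg | ihg
        · left; exact inv_mem ihg
        · right
          have : g⁻¹ * a = (a * g)⁻¹ * (a * a) := by group
          rw [this]
          exact mul_mem (inv_mem (sw _ hg _ haD ihg)) haaH
    rw [Subgroup.index_eq_two_iff]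
    refine ⟨⟨a, haD⟩, ?_⟩
    rintro ⟨d, hd⟩
    simp only [Subgroup.mem_subgroupOf, Subgroup.coe_mul]
    by_cases hdH : d ∈ H
    · right
      refine ⟨hdH, fun h0 => haH ?_⟩
      simpa using mul_mem (inv_mem hdH) h0
    · left
      exact ⟨(tot d hd).resolve_left hdH, hdH⟩

end Core


/-- (Proposition 5.4, non-abelian case) If `S = {e, x, y, x·y}` is the
Steiner loop of order 4, identity (∗) holds with all `f(z,z)` central, and the group
`D = ⟨h(x), h(y), h(x·y)⟩` is non-abelian, then the commutator subgroup `D′` of `D` is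
cyclic of order 3, `D′ ∩ Z(D)` is trivial, and `⟨D′, Z(D)⟩` has index 2 in `D`. -/
theorem stmt7 {S : Type*} [Mul S] (e : S)
    (hid : ∀ x : S, e * x = x)
    (hcomm : ∀ x y : S, x * y = y * x)
    (hss : ∀ x y : S, x * (x * y) = y)
    (hcard : Nat.card S = 4)
    (x y : S) (hx : x ≠ e) (hy : y ≠ e) (hxy : x ≠ y)
    {A : Type*} [Group A] (h : S → A) (f : S → S → A)
    (hfc : ∀ z : S, f z z ∈ Subgroup.center A)
    (hstar : ∀ u v : S, u ≠ e → v ≠ e → u ≠ v →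
      h u * h v * h u * h (u * v) = f u u)
    (hnab : ¬ ∀ a ∈ Subgroup.closure ({h x, h y, h (x * y)} : Set A),
        ∀ b ∈ Subgroup.closure ({h x, h y, h (x * y)} : Set A), a * b = b * a) :
    let D : Subgroup A := Subgroup.closure {h x, h y, h (x * y)}
    let D' : Subgroup A := ⁅D, D⁆
    let ZD : Subgroup A := D ⊓ Subgroup.centralizer (D : Set A)
    IsCyclic D' ∧ Nat.card D' = 3 ∧ D' ⊓ ZD = ⊥ ∧
      ((D' ⊔ ZD).subgroupOf D).index = 2 := by
  have xe : ∀ u : S, u * e = u := fun u => by rw [hcomm, hid]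
  have xx : ∀ u : S, u * u = e := fun u => by
    have := hss u e
    rwa [xe] at this
  have n1 : x * y ≠ e := by
    intro h0
    have := hss x y
    rw [h0, xe] at this
    exact hxy this
  have n2 : x * y ≠ x := by
    intro h0
    have := hss x y
    rw [h0, xx] at this
    exact hy this.symm
  have h1 := hstar x y hx hy hxy
  have h2 := hstar y x hy hx hxy.symm
  have h3 := hstar (x * y) x n1 hx n2
  rw [hcomm y x] at h2
  rw [hcomm (x * y) x, hss] at h3
  exact core _ _ _ _ _ _ (hfc x) (hfc y) (hfc (x * y)) h1 h2 h3 hnab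
end

section
/- Let L be a Steiner-like loop determined by data (S, A, h, f). Then L is flexible, i.e. (p·q)·p = p·(q·p) for all p, q ∈ L, if and only if f(x,y) lies in the centre of A for all x, y ∈ S. -/
/-- Multiplication of the Steiner-like loop `L` on `S × A`:
`(x,ξ)(y,η) = (x·y, f(x,y)·ξ·η)`. -/
def steinerMul {S A : Type*} [Mul S] [Group A] (f : S → S → A) (p q : S × A) : S × A :=
  (p.1 * q.1, f p.1 q.1 * p.2 * q.2)

/-- (Proposition 6.1) A Steiner-like loop `L` is flexible iff all the values
`f(x,y)` lie in the centre of `A`. -/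
theorem stmt9 {S : Type*} [Mul S] (e : S)
    (hid : ∀ x : S, e * x = x)
    (hcomm : ∀ x y : S, x * y = y * x)
    (hss : ∀ x y : S, x * (x * y) = y)
    {A : Type*} [Group A] (h : S → A) (f : S → S → A)
    (hfe : ∀ x : S, f x e = 1) (hef : ∀ x : S, f e x = 1)
    (hfh : ∀ x y : S, x ≠ e → y ≠ e → x ≠ y → f x y = h x * h y) :
    (∀ p q : S × A, steinerMul f (steinerMul f p q) p = steinerMul f p (steinerMul f q p)) ↔
      (∀ x y : S, f x y ∈ Subgroup.center A) := by
  constructor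
  · intro H x y
    rw [Subgroup.mem_center_iff]
    have key : ∀ ξ : A, f (y * x) y * f y x * ξ = f y (y * x) * ξ * f x y := by
      intro ξ
      have h1 := congrArg Prod.snd (H (y, ξ) (x, 1))
      simp only [steinerMul, mul_one, hcomm x y] at h1
      have h2 : (f (y * x) y * f y x * ξ) * ξ = (f y (y * x) * ξ * f x y) * ξ := by
        simpa only [mul_assoc] using h1
      exact mul_right_cancel h2
    intro g
    have k1 := key 1
    have kg := key g
    simp only [mul_one] at k1
    rw [k1, mul_assoc, mul_assoc] at kg
    exact (mul_left_cancel kg).symm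
  · intro H
    have C : ∀ x y (g : A), g * f x y = f x y * g := fun x y g =>
      Subgroup.mem_center_iff.1 (H x y) g
    have sym : ∀ x y, f x y = f y x := by
      intro x y
      by_cases hx : x = e
      · rw [hx, hfe, hef]
      by_cases hy : y = e
      · rw [hy, hfe, hef]
      by_cases hxy : x = y
      · rw [hxy]
      have c := C x y (h x)
      rw [hfh x y hx hy hxy, mul_assoc] at c
      rw [hfh x y hx hy hxy, hfh y x hy hx (Ne.symm hxy)]
      exact mul_left_cancel c
    rintro ⟨x, ξ⟩ ⟨y, η⟩
    simp only [steinerMul]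
    refine Prod.ext ?_ ?_
    · change x * y * x = x * (y * x)
      rw [hcomm (x * y) x, hcomm y x]
    · change f (x * y) x * (f x y * ξ * η) * ξ = f x (y * x) * ξ * (f y x * η * ξ)
      rw [hcomm y x, sym (x * y) x, sym y x, ← C x y ξ]
      simp only [mul_assoc]
end

section
/- Let L be a Steiner-like loop determined by data (S, A, h, f). Then the following are equivalent: (a) L is right alternative, i.e. (q·p)·p = q·(p·p) for all p, q ∈ L; (b) L satisfies the right inverse property, i.e. (q·p)·Jr(p) = q for all p, q ∈ L, where Jr(x,ξ) = (x, ξ⁻¹·f(x,x)⁻¹) is the right inverse map; (c) f(x,x) lies in the centre of A for every x ∈ S and identity (∗) holds: h(x)h(y)h(x)h(x·y) = f(x,x) for all distinct x, y ∈ S ∖ {e}. -/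
/-- (Proposition 6.2) For a Steiner-like loop `L` the following are
equivalent: (a) `L` is right alternative; (b) `L` has the right inverse property, where
the right inverse of `(x,ξ)` is `(x, ξ⁻¹·f(x,x)⁻¹)`; (c) all `f(x,x)` are central in `A`
and identity (∗) `h(x)h(y)h(x)h(x·y) = f(x,x)` holds for distinct non-identity `x, y`. -/
theorem stmt10 {S : Type*} [Mul S] (e : S)
    (hid : ∀ x : S, e * x = x)
    (hcomm : ∀ x y : S, x * y = y * x)
    (hss : ∀ x y : S, x * (x * y) = y)
    {A : Type*} [Group A] (h : S → A) (f : S → S → A)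
    (hfe : ∀ x : S, f x e = 1) (hef : ∀ x : S, f e x = 1)
    (hfh : ∀ x y : S, x ≠ e → y ≠ e → x ≠ y → f x y = h x * h y) :
    ((∀ p q : S × A, steinerMul f (steinerMul f q p) p = steinerMul f q (steinerMul f p p)) ↔
      ((∀ x : S, f x x ∈ Subgroup.center A) ∧
        ∀ x y : S, x ≠ e → y ≠ e → x ≠ y → h x * h y * h x * h (x * y) = f x x)) ∧
    ((∀ p q : S × A, steinerMul f (steinerMul f q p) (p.1, p.2⁻¹ * (f p.1 p.1)⁻¹) = q) ↔
      ((∀ x : S, f x x ∈ Subgroup.center A) ∧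
        ∀ x y : S, x ≠ e → y ≠ e → x ≠ y → h x * h y * h x * h (x * y) = f x x)) := by
  have hxe : ∀ x : S, x * e = x := fun x => by rw [hcomm, hid]
  have hxx : ∀ x : S, x * x = e := fun x => by
    have := hss x e
    rwa [hxe] at this
  have hyx : ∀ x y : S, y * x * x = y := fun x y => by
    rw [hcomm (y * x) x, hcomm y x, hss]
  have hne1 : ∀ x y : S, x ≠ y → y * x ≠ e := fun x y hxy hh => by
    have := hyx x y
    rw [hh, hid] at this
    exact hxy this
  have hne2 : ∀ x y : S, y ≠ e → y * x ≠ x := fun x y hy hh => by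
    have := hyx x y
    rw [hh, hxx] at this
    exact hy this.symm
  have key : (∀ (x y : S) (η : A), f (y * x) x * f y x * η = η * f x x) ↔
      ((∀ x : S, f x x ∈ Subgroup.center A) ∧
        ∀ x y : S, x ≠ e → y ≠ e → x ≠ y → h x * h y * h x * h (x * y) = f x x) := by
    constructor
    · intro H
      have hc : ∀ (x : S) (η : A), f x x * η = η * f x x := fun x η => by
        have := H x e η
        rwa [hid, hef, mul_one] at this
      refine ⟨fun x => Subgroup.mem_center_iff.mpr fun g => (hc x g).symm, ?_⟩
      intro x y hx hy hxy
      have h1 := H x y 1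
      rw [hfh _ _ (hne1 x y hxy) hx (hne2 x y hy), hfh y x hy hx (Ne.symm hxy),
        mul_one, one_mul] at h1
      have h2 := hc x (h (y * x))
      rw [← h1] at h2 ⊢
      rw [hcomm x y]
      apply mul_left_cancel (a := h (y * x))
      rw [← h2]
      simp only [mul_assoc]
    · rintro ⟨hc, hs⟩ x y η
      have hc' : ∀ (x : S) (η : A), η * f x x = f x x * η := fun x η =>
        Subgroup.mem_center_iff.mp (hc x) η
      rw [hc']
      congr 1
      by_cases hy : y = e
      · subst hy
        rw [hid, hef, mul_one]
      by_cases hx : x = e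
      · subst hx
        rw [hfe, hfe, hfe, mul_one]
      by_cases hxy : x = y
      · subst hxy
        rw [hxx, hef, one_mul]
      rw [hfh _ _ (hne1 x y hxy) hx (hne2 x y hy), hfh y x hy hx (Ne.symm hxy)]
      have h1 := hs x y hx hy hxy
      have h2 := hc' x (h (y * x))
      rw [hcomm x y] at h1
      apply mul_right_cancel (b := h (y * x))
      rw [← h2, ← h1]
      simp only [mul_assoc]
  constructor
  · rw [← key]
    constructor
    · intro H x y η
      have := congrArg Prod.snd (H (x, 1) (y, η))
      simpa [steinerMul, hxx, hfe, mul_assoc] using this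
    · rintro H ⟨x, ξ⟩ ⟨y, η⟩
      have h1 := H x y η
      refine Prod.ext ?_ ?_
      · simp [steinerMul, hxx, hyx, hxe]
      · simp only [steinerMul, hxx, hfe, one_mul]
        calc _ = (f (y * x) x * f y x * η) * ξ * ξ := by simp only [mul_assoc]
          _ = _ := by rw [h1]; simp only [mul_assoc]
  · rw [← key]
    constructor
    · intro H x y η
      have := congrArg Prod.snd (H (x, 1) (y, η))
      simp only [steinerMul, mul_one, inv_one, one_mul] at this
      rw [mul_inv_eq_iff_eq_mul] at this
      rw [← this, mul_assoc]
    · rintro H ⟨x, ξ⟩ ⟨y, η⟩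
      have h1 := H x y η
      refine Prod.ext ?_ ?_
      · simp [steinerMul, hyx]
      · simp only [steinerMul]
        calc _ = (f (y * x) x * f y x * η) * (f x x)⁻¹ := by group
          _ = _ := by rw [h1]; group
end

section
/- Let L be a Steiner-like loop determined by data (S, A, h, f). Then the following are equivalent: (a) L is left alternative, i.e. p·(p·q) = (p·p)·q for all p, q ∈ L; (b) L satisfies the left inverse property, i.e. Jl(p)·(p·q) = q for all p, q ∈ L, where Jl(x,ξ) = (x, f(x,x)⁻¹·ξ⁻¹) is the left inverse map; (c) f(x,x) lies in the centre of A for every x ∈ S, h(x)·h(y) lies in the centre of A for all distinct x, y ∈ S ∖ {e}, and identity (∗) holds: h(x)h(y)h(x)h(x·y) = f(x,x) for all distinct x, y ∈ S ∖ {e}. -/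
/-- (Proposition 6.3) For a Steiner-like loop `L` the following are
equivalent: (a) `L` is left alternative; (b) `L` has the left inverse property, where the
left inverse of `(x,ξ)` is `(x, f(x,x)⁻¹·ξ⁻¹)`; (c) all `f(x,x)` and all products
`h(x)·h(y)` (for distinct non-identity `x, y`) are central in `A` and identity (∗)
`h(x)h(y)h(x)h(x·y) = f(x,x)` holds for distinct non-identity `x, y`. -/
theorem stmt11 {S : Type*} [Mul S] (e : S)
    (hid : ∀ x : S, e * x = x)
    (hcomm : ∀ x y : S, x * y = y * x)
    (hss : ∀ x y : S, x * (x * y) = y)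
    {A : Type*} [Group A] (h : S → A) (f : S → S → A)
    (hfe : ∀ x : S, f x e = 1) (hef : ∀ x : S, f e x = 1)
    (hfh : ∀ x y : S, x ≠ e → y ≠ e → x ≠ y → f x y = h x * h y) :
    ((∀ p q : S × A, steinerMul f p (steinerMul f p q) = steinerMul f (steinerMul f p p) q) ↔
      ((∀ x : S, f x x ∈ Subgroup.center A) ∧
        (∀ x y : S, x ≠ e → y ≠ e → x ≠ y → h x * h y ∈ Subgroup.center A) ∧
        ∀ x y : S, x ≠ e → y ≠ e → x ≠ y → h x * h y * h x * h (x * y) = f x x)) ∧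
    ((∀ p q : S × A, steinerMul f (p.1, (f p.1 p.1)⁻¹ * p.2⁻¹) (steinerMul f p q) = q) ↔
      ((∀ x : S, f x x ∈ Subgroup.center A) ∧
        (∀ x y : S, x ≠ e → y ≠ e → x ≠ y → h x * h y ∈ Subgroup.center A) ∧
        ∀ x y : S, x ≠ e → y ≠ e → x ≠ y → h x * h y * h x * h (x * y) = f x x)) := by
  have hxe : ∀ x : S, x * e = x := fun x => by rw [hcomm, hid]
  have hxx : ∀ x : S, x * x = e := fun x => by
    have := hss x e
    rwa [hxe] at this
  have key : (∀ (x y : S) (t : A), f x (x * y) * t * f x y = f x x * t) ↔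
      ((∀ x : S, f x x ∈ Subgroup.center A) ∧
        (∀ x y : S, x ≠ e → y ≠ e → x ≠ y → h x * h y ∈ Subgroup.center A) ∧
        ∀ x y : S, x ≠ e → y ≠ e → x ≠ y → h x * h y * h x * h (x * y) = f x x) := by
    have n1 : ∀ x y : S, x ≠ y → x * y ≠ e := fun x y hxy h0 => by
      have := hss x y
      rw [h0, hxe] at this
      exact hxy this
    have n2 : ∀ x y : S, y ≠ e → x ≠ x * y := fun x y hy h0 => by
      have := hss x y
      rw [← h0, hxx] at this
      exact hy this.symm
    constructor
    · intro H
      have c2 : ∀ x y : S, x ≠ e → y ≠ e → x ≠ y → h x * h y ∈ Subgroup.center A := by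
        intro x y hx hy hxy
        rw [Subgroup.mem_center_iff]
        intro t
        rw [← hfh x y hx hy hxy]
        have h1 := H x y 1
        have h2 := H x y t
        rw [mul_one, mul_one] at h1
        rw [← h1, mul_assoc, mul_assoc] at h2
        exact mul_left_cancel h2
      refine ⟨?_, c2, ?_⟩
      · intro x
        rw [Subgroup.mem_center_iff]
        intro t
        have := H x x t
        rwa [hxx, hfe, one_mul] at this
      · intro x y hx hy hxy
        have h1 := H x y 1
        rw [mul_one, mul_one, hfh x y hx hy hxy, hfh x (x * y) hx (n1 x y hxy) (n2 x y hy),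
          Subgroup.mem_center_iff.1 (c2 x y hx hy hxy)] at h1
        rw [← h1, mul_assoc (h x * h y)]
    · rintro ⟨c1, c2, c3⟩ x y t
      by_cases hx : x = e
      · subst hx
        simp [hef]
      by_cases hy : y = e
      · subst hy
        simp [hxe, hfe]
      by_cases hxy : x = y
      · subst hxy
        rw [hxx, hfe, one_mul]
        exact Subgroup.mem_center_iff.1 (c1 x) t
      rw [hfh x y hx hy hxy, hfh x (x * y) hx (n1 x y hxy) (n2 x y hy),
        Subgroup.mem_center_iff.1 (c2 x y hx hy hxy), ← c3 x y hx hy hxy]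
      simp only [mul_assoc]
  rw [← key]
  constructor
  · constructor
    · intro H x y t
      have := congrArg Prod.snd (H (x, t) (y, 1))
      simp only [steinerMul, hxx, hef, mul_one, one_mul, ← mul_assoc] at this
      exact mul_right_cancel this
    · rintro H ⟨x, t⟩ ⟨y, u⟩
      have := H x y t
      simp only [steinerMul, hxx, hss, hid, hef, one_mul, ← mul_assoc, this]
  · have conv : ∀ x y : S, ∀ t : A, f x x ∈ Subgroup.center A →
        (f x (x * y) * (f x x)⁻¹ * t * f x y * t⁻¹ = 1 ↔
          f x (x * y) * t * f x y = f x x * t) := by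
      intro x y t hc
      have hi := Subgroup.mem_center_iff.1 (inv_mem hc)
      rw [hi, mul_inv_eq_one]
      simp only [mul_assoc]
      rw [inv_mul_eq_iff_eq_mul]
    have cen : ∀ x : S, (∀ t : A, t * f x x = f x x * t) → f x x ∈ Subgroup.center A :=
      fun x hx => Subgroup.mem_center_iff.2 hx
    constructor
    · intro H
      have H' : ∀ (x y : S) (t : A), f x (x * y) * (f x x)⁻¹ * t * f x y * t⁻¹ = 1 := by
        intro x y t
        have := congrArg Prod.snd (H (x, t⁻¹) (y, 1))
        simpa [steinerMul, mul_assoc] using this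
      intro x y t
      refine (conv x y t (cen x fun s => ?_)).1 (H' x y t)
      have := H' x x s
      rw [hxx, hfe, one_mul, mul_inv_eq_one, mul_assoc, inv_mul_eq_iff_eq_mul] at this
      exact this
    · rintro H ⟨x, t⟩ ⟨y, u⟩
      have := (conv x y t⁻¹ (key.1 H |>.1 x)).2 (H x y t⁻¹)
      rw [inv_inv] at this
      simp only [steinerMul, hss, ← mul_assoc, this, one_mul]
end

section
/- Let L be a Steiner-like loop determined by data (S, A, h, f). Then L satisfies the cross inverse property, i.e. (p·q)·Jr(p) = q for all p, q ∈ L, where Jr(x,ξ) = (x, ξ⁻¹·f(x,x)⁻¹) is the right inverse map, if and only if the group A is commutative and identity (∗) holds: h(x)h(y)h(x)h(x·y) = f(x,x) for all distinct x, y ∈ S ∖ {e}. -/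
/-- (Proposition 6.4) A Steiner-like loop `L` satisfies the cross inverse
property `(p·q)·Jr(p) = q`, where `Jr(x,ξ) = (x, ξ⁻¹·f(x,x)⁻¹)`, iff `A` is commutative
and identity (∗) `h(x)h(y)h(x)h(x·y) = f(x,x)` holds for distinct non-identity `x, y`. -/
theorem stmt12 {S : Type*} [Mul S] (e : S)
    (hid : ∀ x : S, e * x = x)
    (hcomm : ∀ x y : S, x * y = y * x)
    (hss : ∀ x y : S, x * (x * y) = y)
    {A : Type*} [Group A] (h : S → A) (f : S → S → A)
    (hfe : ∀ x : S, f x e = 1) (hef : ∀ x : S, f e x = 1)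
    (hfh : ∀ x y : S, x ≠ e → y ≠ e → x ≠ y → f x y = h x * h y) :
    (∀ p q : S × A, steinerMul f (steinerMul f p q) (p.1, p.2⁻¹ * (f p.1 p.1)⁻¹) = q) ↔
      ((∀ a b : A, a * b = b * a) ∧
        ∀ x y : S, x ≠ e → y ≠ e → x ≠ y → h x * h y * h x * h (x * y) = f x x) := by
  have hxe : ∀ x : S, x * e = x := fun x => by rw [hcomm, hid]
  have hxx : ∀ x : S, x * x = e := fun x => by
    have h1 := hss x e
    rwa [hxe] at h1
  have hne : ∀ x y : S, x ≠ y → x * y ≠ e := fun x y hxy h1 => by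
    have h2 := hss x y
    rw [h1, hxe] at h2
    exact hxy h2
  have hnx : ∀ x y : S, y ≠ e → x * y ≠ x := fun x y hy h1 => by
    have h2 := hss x y
    rw [h1, hxx] at h2
    exact hy h2.symm
  have key : ∀ x y : S, x ≠ e → y ≠ e → x ≠ y →
      f (x * y) x * f x y = h (x * y) * h x * (h x * h y) := fun x y hx hy hxy => by
    rw [hfh _ _ (hne x y hxy) hx (hnx x y hy), hfh x y hx hy hxy]
  constructor
  · intro H
    have hc : ∀ a b : A, a * b = b * a := fun a b => by
      have h1 := congrArg Prod.snd (H (e, a) (e, b))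
      simp only [steinerMul, hid, hfe, inv_one, mul_one, one_mul] at h1
      exact mul_inv_eq_iff_eq_mul.mp h1
    refine ⟨hc, fun x y hx hy hxy => ?_⟩
    have h1 := congrArg Prod.snd (H (x, 1) (y, 1))
    simp only [steinerMul, inv_one, mul_one, one_mul] at h1
    rw [key x y hx hy hxy] at h1
    rw [← mul_inv_eq_one.mp h1, hc _ (h (x * y)), mul_assoc (h x), hc (h y) (h x),
      ← mul_assoc (h x), mul_assoc, mul_assoc]
  · rintro ⟨hc, H⟩ ⟨x, a⟩ ⟨y, b⟩
    have main : f (x * y) x * f x y = f x x := by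
      by_cases hx : x = e
      · subst hx; simp only [hfe, hef, mul_one]
      by_cases hy : y = e
      · subst hy; rw [hxe, hfe, mul_one]
      by_cases hxy : x = y
      · subst hxy; rw [hxx, hef, one_mul]
      rw [key x y hx hy hxy, ← H x y hx hy hxy, hc _ (h (x * y)), mul_assoc (h x), hc (h y) (h x),
        ← mul_assoc (h x), mul_assoc, mul_assoc]
    refine Prod.ext ?_ ?_
    · simp only [steinerMul]
      rw [hcomm, hss]
    · simp only [steinerMul]
      rw [mul_assoc (f x y) a b, ← mul_assoc (f (x * y) x), main, hc a b, hc (f x x) (b * a),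
        hc a⁻¹]
      group
end

section
/- Let S be a Steiner loop with identity e. Then S satisfies the left Bol identity (x·(y·x))·z = x·(y·(x·z)) for all x, y, z ∈ S if and only if the multiplication of S is associative (so that S is an elementary abelian 2-group); likewise, S satisfies the right Bol identity z·((x·y)·x) = ((z·x)·y)·x for all x, y, z ∈ S if and only if the multiplication of S is associative. -/
/-- (Lemma 6.5) A Steiner loop satisfies the left Bol identity iff its
multiplication is associative, and likewise it satisfies the right Bol identity iff its
multiplication is associative. -/
theorem stmt13 {S : Type*} [Mul S] (e : S)
    (hid : ∀ x : S, e * x = x)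
    (hcomm : ∀ x y : S, x * y = y * x)
    (hss : ∀ x y : S, x * (x * y) = y) :
    ((∀ x y z : S, (x * (y * x)) * z = x * (y * (x * z))) ↔
      (∀ x y z : S, x * y * z = x * (y * z))) ∧
    ((∀ x y z : S, z * ((x * y) * x) = ((z * x) * y) * x) ↔
      (∀ x y z : S, x * y * z = x * (y * z))) := by
  have key : (∀ x y z : S, y * z = x * (y * (x * z))) ↔
      (∀ x y z : S, x * y * z = x * (y * z)) := by
    constructor
    · intro h x y z
      have h1 : x * (z * y) = z * (x * y) := by
        rw [h x z y, hss]
      rw [hcomm (x * y) z, ← h1, hcomm z y]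
    · intro h x y z
      rw [← h y x z, hcomm y x, h x y z, hss]
  have h1 : ∀ x y : S, x * (y * x) = y := fun x y => by rw [hcomm y x, hss]
  have h2 : ∀ x y : S, (x * y) * x = y := fun x y => by rw [hcomm, hss]
  have h3 : ∀ x y z : S, ((z * x) * y) * x = x * (y * (x * z)) := fun x y z => by
    rw [hcomm _ x, hcomm _ y, hcomm z x]
  refine ⟨?_, ?_⟩
  · simp only [h1]
    exact key
  · rw [← key]
    refine forall_congr' fun x => forall_congr' fun y => forall_congr' fun z => ?_
    rw [h2, h3, hcomm z y]
end

section
/- Let L be a Steiner-like loop determined by data (S, A, h, f), where the Steiner loop S has more than four elements. Then the following are equivalent: (i) the multiplication of L is associative (L is a group); (ii) the multiplication of S is associative (so S is an elementary abelian 2-group) and there exists t ∈ A with t² in the centre of A such that h(x) = t and f(x,x) = t⁴ for all x ∈ S ∖ {e}; (iii) L satisfies the left Bol identity (p·(q·p))·r = p·(q·(p·r)) for all p, q, r ∈ L. -/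
theorem key_comm {A : Type*} [CommGroup A] (X Y Z P Q R : A)
    (hE : Y * Z * (X * P) * (Y * X) = X * Q * (Y * R) * (X * Z)) : P * Y = Q * R := by
  have : (X * Y * Z * X) * (P * Y) = (X * Y * Z * X) * (Q * R) := by
    calc _ = Y * Z * (X * P) * (Y * X) := by ac_rfl
      _ = _ := hE
      _ = _ := by ac_rfl
  exact mul_left_cancel this

theorem key_set {A : Type*} [Group A] (s : Set A) (hs : ∀ a ∈ s, ∀ b ∈ s, a * b = b * a)
    (X Y Z P Q R : A) (hX : X ∈ s) (hY : Y ∈ s) (hZ : Z ∈ s) (hP : P ∈ s) (hQ : Q ∈ s)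
    (hR : R ∈ s)
    (hE : Y * Z * (X * P) * (Y * X) = X * Q * (Y * R) * (X * Z)) : P * Y = Q * R := by
  letI := Subgroup.closureCommGroupOfComm (k := s) hs
  have m : ∀ {a}, a ∈ s → a ∈ Subgroup.closure s := fun ha => Subgroup.subset_closure ha
  have := key_comm (A := Subgroup.closure s) ⟨X, m hX⟩ ⟨Y, m hY⟩ ⟨Z, m hZ⟩ ⟨P, m hP⟩ ⟨Q, m hQ⟩
    ⟨R, m hR⟩ (Subtype.ext hE)
  exact congrArg Subtype.val this

theorem exists_out {S : Type*} (hbig : ∃ a b c d g : S, a ≠ b ∧ a ≠ c ∧ a ≠ d ∧ a ≠ g ∧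
      b ≠ c ∧ b ≠ d ∧ b ≠ g ∧ c ≠ d ∧ c ≠ g ∧ d ≠ g) (p q r s : S) :
    ∃ z : S, z ≠ p ∧ z ≠ q ∧ z ≠ r ∧ z ≠ s := by
  classical
  obtain ⟨a, b, c, d, g, h1, h2, h3, h4, h5, h6, h7, h8, h9, h10⟩ := hbig
  by_contra hcon
  have hsub : ({a, b, c, d, g} : Finset S) ⊆ {p, q, r, s} := by
    intro z _
    by_contra hz
    simp only [Finset.mem_insert, Finset.mem_singleton, not_or] at hz
    exact hcon ⟨z, hz⟩
  have h5c : ({a, b, c, d, g} : Finset S).card = 5 := by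
    simp [*]
  have := Finset.card_le_card hsub
  have h4c : ({p, q, r, s} : Finset S).card ≤ 4 := Finset.card_le_four
  omega

theorem bol_imp {S : Type*} [Mul S] (e : S)
    (hid : ∀ x : S, e * x = x)
    (hcomm : ∀ x y : S, x * y = y * x)
    (hss : ∀ x y : S, x * (x * y) = y)
    (hbig : ∃ a b c d g : S, a ≠ b ∧ a ≠ c ∧ a ≠ d ∧ a ≠ g ∧
      b ≠ c ∧ b ≠ d ∧ b ≠ g ∧ c ≠ d ∧ c ≠ g ∧ d ≠ g)
    {A : Type*} [Group A] (h : S → A) (f : S → S → A)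
    (hfe : ∀ x : S, f x e = 1)
    (hfh : ∀ x y : S, x ≠ e → y ≠ e → x ≠ y → f x y = h x * h y)
    (hB : ∀ p q r : S × A,
        steinerMul f (steinerMul f p (steinerMul f q p)) r =
          steinerMul f p (steinerMul f q (steinerMul f p r))) :
    ((∀ x y z : S, x * y * z = x * (y * z)) ∧
        ∃ t : A, t ^ 2 ∈ Subgroup.center A ∧
          ∀ x : S, x ≠ e → h x = t ∧ f x x = t ^ 4) := by
  have hxx : ∀ x : S, x * x = e := fun x => by
    have := hss x e
    rwa [hcomm x e, hid] at this
  have hlc : ∀ x y z : S, x * (y * z) = y * (x * z) := by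
    intro x y z
    have := congrArg Prod.fst (hB (x, 1) (y, 1) (z, 1))
    simp only [steinerMul] at this
    rw [hcomm y x, hss] at this
    rw [this, hss]
  have has : ∀ x y z : S, x * y * z = x * (y * z) := by
    intro x y z
    rw [hcomm (x * y) z, hlc, hcomm z y]
  refine ⟨has, ?_⟩
  have hxe : ∀ x : S, x * e = x := fun x => by rw [hcomm, hid]
  have hE : ∀ (x y z : S) (ξ η : A), f y z * f x (y * x) * ξ * f y x * η =
      f x (y * (x * z)) * ξ * f y (x * z) * η * f x z := by
    intro x y z ξ η
    have := congrArg Prod.snd (hB (x, ξ) (y, η) (z, ξ⁻¹))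
    simp only [steinerMul] at this
    rw [hcomm y x, hss] at this
    rw [hcomm y x]
    simpa [mul_assoc] using this
  have hcen : ∀ (x z : S) (η : A), f x z * η = η * f x z := by
    intro x z η
    have h1 := hE x x z 1 1
    have h2 := hE x x z 1 η
    simp only [mul_one] at h1 h2
    rw [h1] at h2
    simpa [mul_assoc] using h2
  have hE1 : ∀ x y z : S, f y z * f x (y * x) * f y x =
      f x (y * (x * z)) * f y (x * z) * f x z := by
    intro x y z
    simpa using hE x y z 1 1
  have hne : ∀ {x y : S}, x ≠ y → x * y ≠ e := by
    intro x y hxy hc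
    apply hxy
    have := hss x y
    rw [hc, hxe] at this
    exact this
  have hhc : ∀ x y : S, x ≠ e → y ≠ e → h x * h y = h y * h x := by
    intro x y hx hy
    by_cases hxy : x = y
    · rw [hxy]
    have := hcen x y (h x)
    rw [hfh x y hx hy hxy, mul_assoc] at this
    exact (mul_left_cancel this).symm
  have hk : ∀ x y z : S, x ≠ e → y ≠ e → z ≠ e → x ≠ y → x ≠ z → y ≠ z → z ≠ y * x →
      h (y * x) * h y = h (y * (x * z)) * h (x * z) := by
    intro x y z hx hy hz hxy hxz hyz hzyx
    have hyx : y * x ≠ e := hne (Ne.symm hxy)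
    have hxz' : x * z ≠ e := hne hxz
    have h1 : y ≠ x * z := by
      intro hc; apply hzyx; rw [hc, hcomm (x * z) x, hss]
    have h2 : y * (x * z) ≠ e := hne h1
    have h3 : x ≠ y * x := by
      intro hc
      have := hxx x
      nth_rw 2 [hc] at this
      rw [hcomm y x, hss] at this
      exact hy this
    have h4 : x ≠ y * (x * z) := by
      intro hc
      have := hxx x
      nth_rw 2 [hc] at this
      rw [hlc y x, hss] at this
      exact hne hyz this
    have := hE1 x y z
    rw [hfh y z hy hz hyz, hfh x _ hx hyx h3, hfh y x hy hx (Ne.symm hxy), hfh x _ hx h2 h4,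
      hfh y _ hy hxz' h1, hfh x z hx hz hxz] at this
    refine key_set (h '' {x | x ≠ e}) ?_ (h x) (h y) (h z) _ _ _ ⟨x, hx, rfl⟩ ⟨y, hy, rfl⟩
      ⟨z, hz, rfl⟩ ⟨_, hyx, rfl⟩ ⟨_, h2, rfl⟩ ⟨_, hxz', rfl⟩ this
    rintro _ ⟨a, ha, rfl⟩ _ ⟨b, hb, rfl⟩
    exact hhc a b ha hb
  -- reparametrised form
  have hk2 : ∀ a b c : S, a ≠ e → b ≠ e → c ≠ e → a ≠ b → a ≠ c → b ≠ c → c ≠ a * b →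
      h b * h a = h c * h (a * c) := by
    intro a b c ha hb hc hab hac hbc hcab
    have h1 : a * (a * b) = b := hss a b
    have h2 : a * b * (b * c) = a * c := by rw [has, hss]
    have := hk (a * b) a (b * c) (hne hab) ha (hne hbc) ?_ ?_ ?_ ?_
    · rw [h1, h2, hss] at this
      exact this
    · intro h0
      have := hss a b
      rw [h0, hxx] at this
      exact hb this.symm
    · intro h0
      rw [hcomm a b] at h0
      have := congrArg (b * ·) h0
      simp only [hss] at this
      exact hac this
    · intro h0
      apply hcab
      rw [hcomm a b]
      nth_rw 1 [h0]
      rw [hss]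
    · intro h0
      rw [h1] at h0
      have := congrArg (b * ·) h0
      simp only [hss, hxx] at this
      exact hc this
  have hconst : ∀ u v : S, u ≠ e → v ≠ e → h u = h v := by
    intro u v hu hv
    by_cases huv : u = v
    · rw [huv]
    obtain ⟨c, hc1, hc2, hc3, hc4⟩ := exists_out hbig e u v (u * v)
    have hac : u * c ≠ e := hne (Ne.symm hc2)
    have hbc : v * c ≠ e := hne (Ne.symm hc3)
    have hcanc : ∀ x y z : S, x * z = y * z → x = y := by
      intro x y z hh
      rw [hcomm x, hcomm y] at hh
      have := congrArg (z * ·) hh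
      simpa only [hss] using this
    have hab : u * c ≠ v * c := fun hh => huv (hcanc _ _ _ hh)
    have huc : u * c ≠ c := fun hh => hu (hcanc _ _ c (by rw [hh, hid]))
    have hvc : v * c ≠ c := fun hh => hv (hcanc _ _ c (by rw [hh, hid]))
    have hp : u * c * (v * c) = u * v := by
      rw [hcomm v c, has, hss]
    have e1 := hk2 (u * c) (v * c) c hac hbc hc1 hab huc hvc (by rw [hp]; exact hc4)
    have e2 := hk2 (v * c) (u * c) c hbc hac hc1 (Ne.symm hab) hvc huc
      (by rw [hcomm (v * c), hp]; exact hc4)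
    have hcc : ∀ w : S, w * c * c = w := fun w => by rw [has, hxx, hxe]
    rw [hcc] at e1 e2
    rw [hhc _ _ hac hbc, e1] at e2
    exact mul_left_cancel e2
  obtain ⟨x0, hx0, -, -, -⟩ := exists_out hbig e e e e
  refine ⟨h x0, ?_, ?_⟩
  · obtain ⟨y0, hy0, hyx, -, -⟩ := exists_out hbig e x0 e e
    rw [Subgroup.mem_center_iff]
    intro g
    have := hcen x0 y0 g
    rw [hfh _ _ hx0 hy0 (Ne.symm hyx), hconst y0 x0 hy0 hx0, ← pow_two] at this
    exact this.symm
  · intro x hx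
    refine ⟨hconst x x0 hx hx0, ?_⟩
    obtain ⟨y, hy, hyx, -, -⟩ := exists_out hbig e x e e
    have := hE1 x y x
    have h3 : x ≠ y * x := by
      intro hc
      have := hxx x
      nth_rw 2 [hc] at this
      rw [hcomm y x, hss] at this
      exact hy this
    rw [hxx, hxe, hfe, hfh y x hy hx hyx, hfh x y hx hy (Ne.symm hyx),
      hfh x _ hx (hne hyx) h3, hconst y x0 hy hx0, hconst x x0 hx hx0,
      hconst _ x0 (hne hyx) hx0, mul_one] at this
    rw [mul_assoc (h x0 * h x0)] at this
    have h4 := mul_left_cancel this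
    rw [← h4, ← pow_two, ← pow_two, ← pow_mul]

theorem cobdry {G : Type*} [Group G] (hG : ∀ a b : G, a * b = b * a) (x y z a b d : G) :
    b * z * a⁻¹ * (x * y * b⁻¹) = x * d * a⁻¹ * (y * z * d⁻¹) := by
  let _ : CommGroup G := { (inferInstance : Group G) with mul_comm := hG }
  calc _ = (x * y * z * a⁻¹) * (b * b⁻¹) := by ac_rfl
    _ = (x * y * z * a⁻¹) * (d * d⁻¹) := by simp
    _ = _ := by ac_rfl

theorem grp_of {S : Type*} [Mul S] (e : S)
    (hid : ∀ x : S, e * x = x)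
    (hcomm : ∀ x y : S, x * y = y * x)
    (hss : ∀ x y : S, x * (x * y) = y)
    {A : Type*} [Group A] (h : S → A) (f : S → S → A)
    (hfe : ∀ x : S, f x e = 1) (hef : ∀ x : S, f e x = 1)
    (hfh : ∀ x y : S, x ≠ e → y ≠ e → x ≠ y → f x y = h x * h y)
    (has : ∀ x y z : S, x * y * z = x * (y * z)) (t : A) (ht : t ^ 2 ∈ Subgroup.center A)
    (hh : ∀ x : S, x ≠ e → h x = t ∧ f x x = t ^ 4) (p q r : S × A) :
    steinerMul f (steinerMul f p q) r = steinerMul f p (steinerMul f q r) := by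
  classical
  have hxx : ∀ x : S, x * x = e := fun x => by
    have := hss x e
    rwa [hcomm x e, hid] at this
  have hxe : ∀ x : S, x * e = x := fun x => by rw [hcomm, hid]
  let c : Subgroup.center A := ⟨t ^ 2, ht⟩
  let u : S → Subgroup.center A := fun x => if x = e then 1 else c
  have hf : ∀ x y, f x y = ((u x * u y * (u (x * y))⁻¹ : Subgroup.center A) : A) := by
    intro x y
    by_cases hx : x = e
    · subst hx; simp [u, hef, hid]
    by_cases hy : y = e
    · subst hy; simp [u, hfe, hxe]
    by_cases hxy : x = y
    · subst hxy
      simp only [u, hx, hxx, if_true, if_false, (hh x hx).2]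
      simp [c, ← pow_add]
    · have hne : x * y ≠ e := by
        intro hc
        apply hxy
        have := hss x y
        rw [hc, hxe] at this
        exact this
      simp only [u, hx, hy, hne, if_false, hfh x y hx hy hxy, (hh x hx).1, (hh y hy).1]
      simp [c, pow_two, mul_assoc]
  obtain ⟨x, ξ⟩ := p
  obtain ⟨y, η⟩ := q
  obtain ⟨z, ζ⟩ := r
  have hc : ∀ (a : A), f y z * a = a * f y z := fun a => by
    rw [hf]; exact (Subgroup.mem_center_iff.1 (Subtype.property _) a).symm
  have hco : f (x * y) z * f x y = f x (y * z) * f y z := by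
    rw [hf, hf x y, hf x (y * z), hf y z, ← Subgroup.coe_mul, ← Subgroup.coe_mul, has]
    congr 1
    exact cobdry (fun a b => Subtype.ext (Subgroup.mem_center_iff.1 b.2 a)) _ _ _ _ _ _
  simp only [steinerMul]
  refine Prod.ext (has x y z) ?_
  show f (x * y) z * (f x y * ξ * η) * ζ = f x (y * z) * ξ * (f y z * η * ζ)
  calc _ = (f (x * y) z * f x y) * ξ * η * ζ := by simp only [mul_assoc]
    _ = f x (y * z) * (f y z * ξ) * η * ζ := by rw [hco]; simp only [mul_assoc]
    _ = _ := by rw [hc ξ]; simp only [mul_assoc]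

/-- (Theorem 6.6) For a Steiner-like loop `L` over a Steiner loop `S`
with more than four elements the following are equivalent: (i) `L` is a group;
(ii) `S` is associative (an elementary abelian 2-group) and there is `t ∈ A` with `t²`
central such that `h(x) = t` and `f(x,x) = t⁴` for all non-identity `x`;
(iii) `L` is a left Bol loop. -/
theorem stmt14 {S : Type*} [Mul S] (e : S)
    (hid : ∀ x : S, e * x = x)
    (hcomm : ∀ x y : S, x * y = y * x)
    (hss : ∀ x y : S, x * (x * y) = y)
    (hbig : ∃ a b c d g : S, a ≠ b ∧ a ≠ c ∧ a ≠ d ∧ a ≠ g ∧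
      b ≠ c ∧ b ≠ d ∧ b ≠ g ∧ c ≠ d ∧ c ≠ g ∧ d ≠ g)
    {A : Type*} [Group A] (h : S → A) (f : S → S → A)
    (hfe : ∀ x : S, f x e = 1) (hef : ∀ x : S, f e x = 1)
    (hfh : ∀ x y : S, x ≠ e → y ≠ e → x ≠ y → f x y = h x * h y) :
    ((∀ p q r : S × A,
        steinerMul f (steinerMul f p q) r = steinerMul f p (steinerMul f q r)) ↔
      ((∀ x y z : S, x * y * z = x * (y * z)) ∧
        ∃ t : A, t ^ 2 ∈ Subgroup.center A ∧
          ∀ x : S, x ≠ e → h x = t ∧ f x x = t ^ 4)) ∧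
    ((∀ p q r : S × A,
        steinerMul f (steinerMul f p q) r = steinerMul f p (steinerMul f q r)) ↔
      (∀ p q r : S × A,
        steinerMul f (steinerMul f p (steinerMul f q p)) r =
          steinerMul f p (steinerMul f q (steinerMul f p r)))) := by
  have h32 := bol_imp e hid hcomm hss hbig h f hfe hfh
  have h13 : (∀ p q r : S × A,
        steinerMul f (steinerMul f p q) r = steinerMul f p (steinerMul f q r)) →
      (∀ p q r : S × A,
        steinerMul f (steinerMul f p (steinerMul f q p)) r =
          steinerMul f p (steinerMul f q (steinerMul f p r))) := by
    intro H p q r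
    rw [H, H]
  have h21 := grp_of e hid hcomm hss h f hfe hef hfh
  refine ⟨⟨fun H => h32 (h13 H), ?_⟩, ⟨h13, fun H => ?_⟩⟩
  · rintro ⟨has, t, ht, hh⟩
    exact h21 has t ht hh
  · obtain ⟨has, t, ht, hh⟩ := h32 H
    exact h21 has t ht hh
end

section
/- Let L be a Steiner-like loop determined by data (S, A, h, f), where the Steiner loop S has exactly four elements (so S is the Klein four-group). Then the following are equivalent: (i) the multiplication of L is associative (L is a group); (ii) L is left alternative, i.e. p·(p·q) = (p·p)·q for all p, q ∈ L; (iii) L has the left inverse property, i.e. Jl(p)·(p·q) = q for all p, q ∈ L, where Jl(x,ξ) = (x, f(x,x)⁻¹·ξ⁻¹); (iv) L satisfies the left Bol identity (p·(q·p))·r = p·(q·(p·r)) for all p, q, r ∈ L. Moreover, L is a commutative group if and only if L has the cross inverse property, i.e. (p·q)·Jr(p) = q for all p, q ∈ L, where Jr(x,ξ) = (x, ξ⁻¹·f(x,x)⁻¹). -/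
theorem stmt15_core {S : Type*} [Mul S] (e : S)
    (hid : ∀ x : S, e * x = x)
    (hcomm : ∀ x y : S, x * y = y * x)
    (hss : ∀ x y : S, x * (x * y) = y)
    (hcard : Nat.card S = 4)
    {A : Type*} [Group A] (h : S → A) (f : S → S → A)
    (hfe : ∀ x : S, f x e = 1) (hef : ∀ x : S, f e x = 1)
    (hfh : ∀ x y : S, x ≠ e → y ≠ e → x ≠ y → f x y = h x * h y)
    (hc : ∀ (x y : S) (ξ : A), f x y * ξ = ξ * f x y)
    (hd : ∀ x y : S, f x (x * y) * f x y = f x x) :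
    ∀ p q r : S × A,
        steinerMul f (steinerMul f p q) r = steinerMul f p (steinerMul f q r) := by
  have hie : ∀ x : S, x * e = x := fun x => by rw [hcomm, hid]
  have hxx : ∀ x : S, x * x = e := fun x => by
    have := hss x e
    rwa [hie] at this
  have hsym : ∀ x y : S, f x y = f y x := by
    intro x y
    by_cases hx : x = e
    · rw [hx, hef, hfe]
    by_cases hy : y = e
    · rw [hy, hef, hfe]
    by_cases hxy : x = y
    · rw [hxy]
    have h1 := hc x y (h x)
    rw [hfh x y hx hy hxy] at h1 ⊢
    rw [hfh y x hy hx (Ne.symm hxy)]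
    rw [mul_assoc] at h1
    exact (mul_left_cancel h1).symm
  have h4 : ∀ x y : S, x ≠ e → y ≠ e → x ≠ y → ∀ z, z = e ∨ z = x ∨ z = y ∨ z = x * y := by
    classical
    intro x y hx hy hxy z
    have : Finite S := Nat.finite_of_card_ne_zero (by omega)
    have := Fintype.ofFinite S
    have h1 : x * y ≠ e := fun hh => hxy (by rw [← hss x y, hh, hie])
    have h2 : x * y ≠ x := fun hh => hy (by rw [← hss x y, hh, hxx])
    have h3 : x * y ≠ y := fun hh => hx (by rw [← hss y x, hcomm y x, hh, hxx])
    have hcd : ({e, x, y, x * y} : Finset S).card = 4 := by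
      rw [Finset.card_insert_of_notMem, Finset.card_insert_of_notMem,
        Finset.card_insert_of_notMem, Finset.card_singleton]
      · simpa using h3.symm
      · simpa using ⟨hxy, h2.symm⟩
      · simpa using ⟨hx.symm, hy.symm, h1.symm⟩
    have hu : ({e, x, y, x * y} : Finset S) = Finset.univ := by
      rw [← Finset.card_eq_iff_eq_univ, hcd, ← Nat.card_eq_fintype_card, hcard]
    have hz := Finset.mem_univ z
    rw [← hu] at hz
    simpa using hz
  have hassoc : ∀ x y z : S, x * y * z = x * (y * z) ∧
      f (x * y) z * f x y = f x (y * z) * f y z := by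
    intro x y z
    by_cases hx : x = e
    · subst hx; simp [hid, hef]
    by_cases hy : y = e
    · subst hy; simp [hid, hie, hef, hfe]
    by_cases hxy : x = y
    · subst hxy; simp [hxx, hid, hss, hef, hd]
    rcases h4 x y hx hy hxy z with rfl | rfl | rfl | rfl
    · simp [hie, hfe]
    · refine ⟨by rw [hcomm z y, hcomm _ z], ?_⟩
      rw [hsym (z * y) z, hcomm y z, hsym y z]
    · refine ⟨by rw [hxx, hie, hcomm, hcomm x z, hss], ?_⟩
      rw [hxx, hfe, one_mul, hsym (x * z) z, hcomm x z, hsym x z, hd]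
    · have e1 : y * (x * y) = x := by rw [hcomm x y, hss]
      refine ⟨by rw [hxx, e1, hxx], ?_⟩
      have e2 : x * y * x = y := by rw [hcomm (x * y), hss]
      have e3 := hd (x * y) x
      rw [e2] at e3
      rw [e1, ← e3, ← hd x y, hsym (x * y) y, hsym (x * y) x, mul_assoc, mul_assoc,
        hc y (x * y), hc x y, mul_assoc]
      exact congrArg _ (hc x y _)
  rintro ⟨x, ξ⟩ ⟨y, η⟩ ⟨z, ζ⟩
  obtain ⟨h1, h2⟩ := hassoc x y z
  simp only [steinerMul, Prod.mk.injEq]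
  refine ⟨h1, ?_⟩
  have h3 : f x (y * z) * ξ * (f y z * η * ζ) = f x (y * z) * f y z * ξ * η * ζ := by
    have := hc y z ξ
    simp only [mul_assoc]
    rw [← mul_assoc ξ, ← this, mul_assoc]
  rw [h3, ← h2]
  simp only [mul_assoc]

/-- (Theorem 6.7) For a Steiner-like loop `L` over the Steiner loop `S` of
order 4 (the Klein four-group) the following are equivalent: (i) `L` is a group;
(ii) `L` is left alternative; (iii) `L` has the left inverse property; (iv) `L` is a
left Bol loop. Moreover, `L` is a commutative group iff `L` has the cross inverse
property. -/
theorem stmt15 {S : Type*} [Mul S] (e : S)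
    (hid : ∀ x : S, e * x = x)
    (hcomm : ∀ x y : S, x * y = y * x)
    (hss : ∀ x y : S, x * (x * y) = y)
    (hcard : Nat.card S = 4)
    {A : Type*} [Group A] (h : S → A) (f : S → S → A)
    (hfe : ∀ x : S, f x e = 1) (hef : ∀ x : S, f e x = 1)
    (hfh : ∀ x y : S, x ≠ e → y ≠ e → x ≠ y → f x y = h x * h y) :
    ((∀ p q r : S × A,
        steinerMul f (steinerMul f p q) r = steinerMul f p (steinerMul f q r)) ↔
      (∀ p q : S × A,
        steinerMul f p (steinerMul f p q) = steinerMul f (steinerMul f p p) q)) ∧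
    ((∀ p q r : S × A,
        steinerMul f (steinerMul f p q) r = steinerMul f p (steinerMul f q r)) ↔
      (∀ p q : S × A,
        steinerMul f (p.1, (f p.1 p.1)⁻¹ * p.2⁻¹) (steinerMul f p q) = q)) ∧
    ((∀ p q r : S × A,
        steinerMul f (steinerMul f p q) r = steinerMul f p (steinerMul f q r)) ↔
      (∀ p q r : S × A,
        steinerMul f (steinerMul f p (steinerMul f q p)) r =
          steinerMul f p (steinerMul f q (steinerMul f p r)))) ∧
    (((∀ p q r : S × A,
        steinerMul f (steinerMul f p q) r = steinerMul f p (steinerMul f q r)) ∧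
      (∀ p q : S × A, steinerMul f p q = steinerMul f q p)) ↔
      (∀ p q : S × A,
        steinerMul f (steinerMul f p q) (p.1, p.2⁻¹ * (f p.1 p.1)⁻¹) = q)) := by
  have core := stmt15_core e hid hcomm hss hcard h f hfe hef hfh
  have hie : ∀ x : S, x * e = x := fun x => by rw [hcomm, hid]
  have hxx : ∀ x : S, x * x = e := fun x => by
    have := hss x e
    rwa [hie] at this
  -- associativity from the left alternative law at the level of `f`
  have key : (∀ (x y : S) (ξ : A), f x (x * y) * ξ * f x y = f x x * ξ) →
      ∀ p q r : S × A,
        steinerMul f (steinerMul f p q) r = steinerMul f p (steinerMul f q r) := by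
    intro H
    have hd : ∀ x y : S, f x (x * y) * f x y = f x x := fun x y => by
      simpa using H x y 1
    refine core (fun x y ξ => ?_) hd
    have h1 := H x y ξ
    rw [← hd x y, mul_assoc, mul_assoc] at h1
    exact (mul_left_cancel h1).symm
  have alt : (∀ p q : S × A,
        steinerMul f p (steinerMul f p q) = steinerMul f (steinerMul f p p) q) →
      ∀ p q r : S × A,
        steinerMul f (steinerMul f p q) r = steinerMul f p (steinerMul f q r) := by
    intro H
    refine key fun x y ξ => ?_
    have h1 := congrArg Prod.snd (H (x, ξ) (y, ξ⁻¹))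
    simpa [steinerMul, hxx, hef, mul_assoc] using h1
  refine ⟨⟨fun H p q => (H p p q).symm, alt⟩, ⟨?_, ?_⟩, ⟨?_, ?_⟩, ⟨?_, ?_⟩⟩
  · rintro H ⟨x, ξ⟩ ⟨y, η⟩
    rw [← H]
    simp [steinerMul, hxx, hef, hid]
  · intro H
    have hL : ∀ (x y : S) (ξ : A), f x (x * y) * (f x x)⁻¹ * ξ⁻¹ * f x y * ξ = 1 := by
      intro x y ξ
      have h1 := congrArg Prod.snd (H (x, ξ) (y, 1))
      simpa [steinerMul, mul_assoc] using h1
    have hcx : ∀ (x : S) (ξ : A), f x x * ξ = ξ * f x x := by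
      intro x ξ
      have h1 := hL x x ξ
      rw [hxx, hfe, one_mul, mul_assoc, ← mul_inv_rev] at h1
      exact inv_mul_eq_one.mp h1 |>.symm
    refine key fun x y ξ => ?_
    have h1 := hL x y ξ⁻¹
    rw [mul_inv_eq_one, inv_inv] at h1
    conv_rhs => rw [← h1, hcx]
    have h2 := hcx x (ξ * f x y)
    simp only [mul_assoc] at h2 ⊢
    rw [← h2, inv_mul_cancel_left]
  · intro H p q r
    rw [H, H]
  · intro H
    refine alt fun p q => ?_
    have h1 := H p (e, 1) q
    have h2 : ∀ p : S × A, steinerMul f (e, 1) p = p := fun p => by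
      simp [steinerMul, hid, hef]
    rw [h2, h2] at h1
    exact h1.symm
  · rintro ⟨H, hC⟩ ⟨x, ξ⟩ ⟨y, η⟩
    rw [hC (x, ξ), H]
    simp [steinerMul, hxx, hie, hfe]
  · intro H
    have hA : ∀ a b : A, a * b = b * a := by
      intro a b
      have h1 := congrArg Prod.snd (H (e, a) (e, b))
      simp only [steinerMul, hid, hef, one_mul, inv_one, mul_one] at h1
      exact mul_inv_eq_iff_eq_mul.mp h1
    have hd : ∀ x y : S, f x y * f (x * y) x = f x x := by
      intro x y
      have h1 := congrArg Prod.snd (H (x, 1) (y, 1))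
      simp only [steinerMul, one_mul, mul_one, inv_one] at h1
      rw [mul_inv_eq_one] at h1
      rw [hA, h1]
    have hs : ∀ x y : S, f x y = f y x := by
      intro x y
      by_cases hx : x = e
      · rw [hx, hef, hfe]
      by_cases hy : y = e
      · rw [hy, hef, hfe]
      by_cases hxy : x = y
      · rw [hxy]
      rw [hfh x y hx hy hxy, hfh y x hy hx (Ne.symm hxy), hA]
    refine ⟨core (fun x y ξ => hA _ _) fun x y => ?_, ?_⟩
    · rw [hA, hs x (x * y), hd]
    · rintro ⟨x, ξ⟩ ⟨y, η⟩
      simp only [steinerMul, Prod.mk.injEq]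
      refine ⟨hcomm x y, ?_⟩
      rw [hs x y, mul_assoc, mul_assoc, hA ξ η]
end

section
/- Let L be a Steiner-like loop determined by data (S, A, h, f). (a) If S has exactly four elements, then L satisfies the right Bol identity r·((p·q)·p) = ((r·p)·q)·p for all p, q, r ∈ L if and only if the values of h commute pairwise, f(x,x) lies in the centre of A for every x ∈ S, and identity (∗) holds: h(x)h(y)h(x)h(x·y) = f(x,x) for all distinct x, y ∈ S ∖ {e}. (b) If S has more than four elements, then L satisfies the right Bol identity and its multiplication is not associative if and only if the multiplication of S is associative and there exists t ∈ A with t⁴ in the centre of A but t² not in the centre of A such that h(x) = t and f(x,x) = t⁴ for all x ∈ S ∖ {e}. -/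
section
variable {S : Type*} [Mul S] {A : Type*} [Group A]

theorem bol_iff (e : S)
    (hid : ∀ x : S, e * x = x)
    (hcomm : ∀ x y : S, x * y = y * x)
    (hss : ∀ x y : S, x * (x * y) = y)
    (f : S → S → A) :
    (∀ p q r : S × A,
          steinerMul f r (steinerMul f (steinerMul f p q) p) =
            steinerMul f (steinerMul f (steinerMul f r p) q) p) ↔
    ((∀ x y z : S, x * y * z = x * (y * z)) ∧
     (∀ x y : S, ∀ k : A, k * (f (x * y) x * f x y) = (f (x * y) x * f x y) * k) ∧
     (∀ x y z : S, f z y * (f (x * y) x * f x y) =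
        f (z * x * y) x * f (z * x) y * f z x)) := by
  have hs2 : ∀ x y : S, x * y * x = y := fun x y => by rw [hcomm, hss]
  simp only [steinerMul, Prod.forall, Prod.mk.injEq, hs2]
  constructor
  · intro H
    have h0 : ∀ x y z : S, z * y = z * x * y * x := fun x y z => (H x 1 y 1 z 1).1
    have h2 : ∀ x y z : S, f z y * (f (x * y) x * f x y) =
        f (z * x * y) x * f (z * x) y * f z x := fun x y z => by
      have := (H x 1 y 1 z 1).2
      simpa [mul_assoc] using this
    refine ⟨?_, ?_, h2⟩
    · intro x y z
      have h3 := h0 x y z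
      have : z * x * y = x * (z * y) := by
        rw [h3, hcomm (z * x * y) x, hss]
      grind
    · intro x y k
      have h3 := (H x 1 y 1 e k).2
      have h4 := h2 x y e
      simp only [mul_one] at h3
      have h5 : f e y * (k * (f (x * y) x * f x y)) = f e y * ((f (x * y) x * f x y) * k) := by
        rw [← mul_assoc (f e y) _ k, h4]
        simpa [mul_assoc] using h3
      exact mul_left_cancel h5
  · rintro ⟨h0, h1, h2⟩ x ξ y η z ζ
    constructor
    · have a1 : z * x * y = x * (z * y) := by rw [hcomm z x, h0]
      rw [a1, hs2]
    · have h4 : f z y * ζ * (f (x * y) x * f x y) =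
        f (z * x * y) x * f (z * x) y * f z x * ζ := by
        rw [mul_assoc (f z y), h1, ← mul_assoc, h2]
      have h5 := congrArg (fun w => w * ξ * η * ξ) h4
      simpa [mul_assoc] using h5

theorem comm_aux (a b c : A)
    (hX : ∀ k : A, k * (c * a * (a * b)) = c * a * (a * b) * k)
    (hF : ∀ k : A, k * (c * a * (b * a)) = c * a * (b * a) * k)
    (hr : a * b * (c * a * (a * b)) = b * a * (c * a * (b * a))) : c * b = b * c := by
  generalize hXe : c * a * (a * b) = X at *
  generalize hFe : c * a * (b * a) = F at *
  have e1 : b * a * a * F = a * b * a * X := by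
    rw [mul_assoc, hF a, ← mul_assoc, ← hr, mul_assoc, ← hX a, ← mul_assoc]
  have e2 : a * a * b * F = a * b * a * X := by
    apply mul_left_cancel (a := c)
    calc c * (a * a * b * F) = c * a * (a * b) * F := by group
      _ = c * a * (b * a) * X := by rw [hXe, hFe, hF]
      _ = _ := by group
  have e3 : b * a * a = a * a * b := mul_right_cancel (e1.trans e2.symm)
  have e4 := hX b
  rw [← hXe] at e4
  have e5 : c * a * (a * b) = b * (c * a * a) := by
    apply mul_right_cancel (b := b)
    rw [← e4]; group
  apply mul_right_cancel (b := a * a)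
  calc c * b * (a * a) = c * (b * a * a) := by group
    _ = c * a * (a * b) := by rw [e3]; group
    _ = _ := by rw [e5]; group

theorem const_aux (x v y u w z : A)
    (cxv : x * v = v * x) (cxy : x * y = y * x) (cxw : x * w = w * x) (cxz : x * z = z * x) (cvy : v * y = y * v) (cvw : v * w = w * v) (cvz : v * z = z * v) (cyw : y * w = w * y) (cyz : y * z = z * y)
    (k1 : v * y * (w * x * (x * y)) = u * x * (z * y) * (v * x))
    (k3 : x * y * x * w = x * v * x * z) : v = u := by
  have lxv : ∀ k, v * (x * k) = x * (v * k) := fun k => by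
    rw [← mul_assoc, ← cxv, mul_assoc]
  have lxy : ∀ k, y * (x * k) = x * (y * k) := fun k => by
    rw [← mul_assoc, ← cxy, mul_assoc]
  have lxw : ∀ k, w * (x * k) = x * (w * k) := fun k => by
    rw [← mul_assoc, ← cxw, mul_assoc]
  have lxz : ∀ k, z * (x * k) = x * (z * k) := fun k => by
    rw [← mul_assoc, ← cxz, mul_assoc]
  have lvy : ∀ k, y * (v * k) = v * (y * k) := fun k => by
    rw [← mul_assoc, ← cvy, mul_assoc]
  have lvw : ∀ k, w * (v * k) = v * (w * k) := fun k => by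
    rw [← mul_assoc, ← cvw, mul_assoc]
  have lvz : ∀ k, z * (v * k) = v * (z * k) := fun k => by
    rw [← mul_assoc, ← cvz, mul_assoc]
  have lyw : ∀ k, w * (y * k) = y * (w * k) := fun k => by
    rw [← mul_assoc, ← cyw, mul_assoc]
  have lyz : ∀ k, z * (y * k) = y * (z * k) := fun k => by
    rw [← mul_assoc, ← cyz, mul_assoc]
  apply mul_right_cancel (b := y * (x * v * x * z))
  have e1 : u * (y * (x * v * x * z)) = u * x * (z * y) * (v * x) := by
    simp only [mul_assoc, ← cxv, lxv, ← cxy, lxy, ← cxw, lxw, ← cxz, lxz, ← cvy, lvy, ← cvw, lvw, ← cvz, lvz, ← cyw, lyw, ← cyz, lyz]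
  have e2 : v * y * (w * x * (x * y)) = v * (y * (x * y * x * w)) := by
    simp only [mul_assoc, ← cxv, lxv, ← cxy, lxy, ← cxw, lxw, ← cxz, lxz, ← cvy, lvy, ← cvw, lvw, ← cvz, lvz, ← cyw, lyw, ← cyz, lyz]
  rw [e1, ← k1, e2, k3]

/-- Consequences of the reduced Bol identities. -/
theorem bol_cons (e : S)
    (hid : ∀ x : S, e * x = x)
    (hcomm : ∀ x y : S, x * y = y * x)
    (hss : ∀ x y : S, x * (x * y) = y)
    (h : S → A) (f : S → S → A)
    (hfe : ∀ x : S, f x e = 1) (hef : ∀ x : S, f e x = 1)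
    (hfh : ∀ x y : S, x ≠ e → y ≠ e → x ≠ y → f x y = h x * h y)
    (h0 : ∀ x y z : S, x * y * z = x * (y * z))
    (h1 : ∀ x y : S, ∀ k : A, k * (f (x * y) x * f x y) = (f (x * y) x * f x y) * k)
    (h2 : ∀ x y z : S, f z y * (f (x * y) x * f x y) =
        f (z * x * y) x * f (z * x) y * f z x) :
    ((∀ x y : S, x ≠ e → y ≠ e → h x * h y = h y * h x) ∧
          (∀ x : S, f x x ∈ Subgroup.center A) ∧
          (∀ x y : S, x ≠ e → y ≠ e → x ≠ y →
            h x * h y * h x * h (x * y) = f x x)) := by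
  have hide : ∀ x : S, x * e = x := fun x => by rw [hcomm, hid]
  have hxx : ∀ x : S, x * x = e := fun x => by simpa [hide] using hss x e
  have hcen : ∀ x : S, ∀ k : A, k * f x x = f x x * k := fun x k => by
    simpa [hxx, hef] using h1 x x k
  have p1 : ∀ x z : S, f x x = f (z * x) x * f z x := fun x z => by
    simpa [hide, hfe] using h2 x e z
  have hne : ∀ x y : S, x ≠ y → x * y ≠ e := fun x y n he => n (by
    have := hss x y
    rw [he, hide] at this; exact this)
  have hnx : ∀ x y : S, y ≠ e → x * y ≠ x := fun x y n he => n (by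
    have := hss x y
    rw [he, hxx] at this; exact this.symm)
  have cm : ∀ x y : S, x ≠ e → y ≠ e → x ≠ y → h (x * y) * h y = h y * h (x * y) := by
    intro x y hx hy hxy
    have n1 := hne x y hxy
    have n2 := hnx x y hy
    have a1 := h1 x y
    have a2 := p1 x y
    have a3 := h2 x y x
    rw [hfh _ _ n1 hx n2, hfh _ _ hx hy hxy] at a1
    rw [hcomm y x, hfh _ _ n1 hx n2, hfh _ _ hy hx hxy.symm] at a2
    rw [hxx, hid, hef, hfh _ _ n1 hx n2, hfh _ _ hx hy hxy, hfh _ _ hy hx hxy.symm, a2,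
      mul_one] at a3
    have a4 := hcen x
    rw [a2] at a4
    exact comm_aux (h x) (h y) (h (x * y)) a1 a4 a3
  have cmm : ∀ x y : S, x ≠ e → y ≠ e → h x * h y = h y * h x := by
    intro x y hx hy
    by_cases hxy : x = y
    · rw [hxy]
    have := cm (y * x) y (hne _ _ (Ne.symm hxy)) hy (hnx y x hx)
    rwa [hcomm (y * x), hss] at this
  refine ⟨cmm, fun x => Subgroup.mem_center_iff.2 (hcen x), ?_⟩
  intro x y hx hy hxy
  have n1 := hne x y hxy
  have n2 := hnx x y hy
  have a2 := p1 x y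
  rw [hcomm y x, hfh _ _ n1 hx n2, hfh _ _ hy hx hxy.symm] at a2
  have q1 : Commute (h (x * y)) (h x) := cmm _ _ n1 hx
  have q2 : Commute (h (x * y)) (h y) := cmm _ _ n1 hy
  rw [a2, ← ((q1.mul_right q2).mul_right q1).eq]
  simp only [mul_assoc]

theorem four_cons (e : S)
    (hid : ∀ x : S, e * x = x)
    (hcomm : ∀ x y : S, x * y = y * x)
    (hss : ∀ x y : S, x * (x * y) = y)
    (h : S → A) (f : S → S → A)
    (hfe : ∀ x : S, f x e = 1) (hef : ∀ x : S, f e x = 1)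
    (hfh : ∀ x y : S, x ≠ e → y ≠ e → x ≠ y → f x y = h x * h y)
    (h4 : Nat.card S = 4)
    (cmm : ∀ x y : S, x ≠ e → y ≠ e → h x * h y = h y * h x)
    (hcen : ∀ x : S, f x x ∈ Subgroup.center A)
    (hst : ∀ x y : S, x ≠ e → y ≠ e → x ≠ y →
            h x * h y * h x * h (x * y) = f x x) :
    ((∀ x y z : S, x * y * z = x * (y * z)) ∧
     (∀ x y : S, ∀ k : A, k * (f (x * y) x * f x y) = (f (x * y) x * f x y) * k) ∧
     (∀ x y z : S, f z y * (f (x * y) x * f x y) =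
        f (z * x * y) x * f (z * x) y * f z x)) := by
  have hide : ∀ x : S, x * e = x := fun x => by rw [hcomm, hid]
  have hxx : ∀ x : S, x * x = e := fun x => by simpa [hide] using hss x e
  have hne : ∀ x y : S, x ≠ y → x * y ≠ e := fun x y n he => n (by
    have := hss x y
    rw [he, hide] at this; exact this)
  have hnx : ∀ x y : S, y ≠ e → x * y ≠ x := fun x y n he => n (by
    have := hss x y
    rw [he, hxx] at this; exact this.symm)
  have hfc : ∀ x y : S, f x y = f y x := by
    intro x y
    by_cases hx : x = e
    · rw [hx, hfe, hef]
    by_cases hy : y = e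
    · rw [hy, hfe, hef]
    by_cases hxy : x = y
    · rw [hxy]
    rw [hfh x y hx hy hxy, hfh y x hy hx (Ne.symm hxy), cmm x y hx hy]
  have hS : ∀ x y z : S, x ≠ e → y ≠ e → x ≠ y → z ≠ e → z ≠ x → z ≠ y → z = x * y := by
    intro x y z hx hy hxy hz hzx hzy
    by_contra hzz
    have : Finite S := Nat.finite_of_card_ne_zero (by omega)
    have := Fintype.ofFinite S
    classical
    have c5 : ({e, x, y, x * y, z} : Finset S).card = 5 := by
      have n1 := hne x y hxy
      have n2 := hnx x y hy
      have n3 := hnx y x hx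
      rw [hcomm] at n3
      repeat rw [Finset.card_insert_of_notMem (by simp; grind)]
      simp
    have := Finset.card_le_univ ({e, x, y, x * y, z} : Finset S)
    rw [Nat.card_eq_fintype_card] at h4
    omega
  have hassoc : ∀ x y z : S, x * y * z = x * (y * z) := by
    intro x y z
    by_cases hx : x = e
    · simp [hx, hid]
    by_cases hy : y = e
    · simp [hy, hid, hide]
    by_cases hz : z = e
    · simp [hz, hide]
    by_cases hxy : x = y
    · simp [hxy, hxx, hss, hid]
    by_cases hzx : z = x
    · rw [hzx, hcomm, hcomm y]
    by_cases hzy : z = y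
    · rw [hzy, hxx, hide, hcomm, hcomm x, hss]
    have := hS x y z hx hy hxy hz hzx hzy
    rw [this, hxx, hcomm x y, hss, hxx]
  have hk : ∀ x : S, ∀ k : A, k * f x x = f x x * k := fun x => Subgroup.mem_center_iff.1 (hcen x)
  have hc : ∀ x y : S, f (x * y) x * f x y = f x x := by
    intro x y
    by_cases hx : x = e
    · simp [hx, hfe, hef]
    by_cases hy : y = e
    · simp [hy, hide, hfe]
    by_cases hxy : x = y
    · simp [hxy, hxx, hef]
    rw [hfh _ _ (hne x y hxy) hx (hnx x y hy), hfh x y hx hy hxy, ← hst x y hx hy hxy]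
    have n1 := hne x y hxy
    calc h (x * y) * h x * (h x * h y) = h (x * y) * h x * (h y * h x) := by rw [cmm x y hx hy]
      _ = h (x * y) * (h x * h y * h x) := by group
      _ = (h x * h y * h x) * h (x * y) := by
        have q1 : Commute (h (x * y)) (h x) := cmm _ _ n1 hx
        have q2 : Commute (h (x * y)) (h y) := cmm _ _ n1 hy
        exact ((q1.mul_right q2).mul_right q1)
  refine ⟨hassoc, fun x y k => by rw [hc, hk], ?_⟩
  intro x y z
  rw [hc]
  by_cases hx : x = e
  · simp [hx, hfe, hef, hide]
  by_cases hy : y = e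
  · simp only [hy, hide, hfe, one_mul, mul_one]
    rw [hfc z x, hcomm z x, hc]
  by_cases hz : z = e
  · simp only [hz, hid, hef, one_mul, mul_one]
    rw [hc]
  by_cases hxy : x = y
  · subst hxy
    rw [hcomm z x, hcomm _ x, hss, mul_assoc, hfc z x, hc]
  by_cases hzx : z = x
  · simp only [hzx, hxx, hid, hef, mul_one]
    rw [hfc x y]
  by_cases hzy : z = y
  · subst hzy
    rw [hcomm (z * x), hss, mul_assoc, hc, hk]
  have hzz := hS x y z hx hy hxy hz hzx hzy
  have e1 : z * x = y := by rw [hzz, hcomm, hss]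
  have n1 := hne x y hxy
  rw [e1, hxx, hef, one_mul, hzz]
  have n3 := hnx y x hx
  rw [hcomm] at n3
  rw [hfh _ _ n1 hy n3, hfh _ _ n1 hx (hnx x y hy), ← hst x y hx hy hxy,
    ← hst y x hy hx (Ne.symm hxy), hcomm y x]
  have q1 : h (x * y) * h x = h x * h (x * y) := cmm _ _ n1 hx
  have q2 : h (x * y) * h y = h y * h (x * y) := cmm _ _ n1 hy
  have q3 : h y * h x = h x * h y := cmm _ _ hy hx
  have l1 : ∀ w, h (x * y) * (h x * w) = h x * (h (x * y) * w) := fun w => by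
    rw [← mul_assoc, q1, mul_assoc]
  have l2 : ∀ w, h (x * y) * (h y * w) = h y * (h (x * y) * w) := fun w => by
    rw [← mul_assoc, q2, mul_assoc]
  have l3 : ∀ w, h y * (h x * w) = h x * (h y * w) := fun w => by
    rw [← mul_assoc, q3, mul_assoc]
  simp only [mul_assoc, q1, q2, q3, l1, l2, l3]

open Classical in
theorem zpow_form (e : S)
    (hid : ∀ x : S, e * x = x)
    (hcomm : ∀ x y : S, x * y = y * x)
    (hss : ∀ x y : S, x * (x * y) = y)
    (h : S → A) (f : S → S → A)
    (hfe : ∀ x : S, f x e = 1) (hef : ∀ x : S, f e x = 1)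
    (hfh : ∀ x y : S, x ≠ e → y ≠ e → x ≠ y → f x y = h x * h y)
    (t : A) (ht : ∀ x : S, x ≠ e → h x = t ∧ f x x = t ^ 4) :
    ∃ n : S → ℤ, (∀ x, n x = if x = e then 0 else 2) ∧
      ∀ x y, f x y = t ^ (n x + n y - n (x * y)) := by
  have hide : ∀ x : S, x * e = x := fun x => by rw [hcomm, hid]
  have hxx : ∀ x : S, x * x = e := fun x => by simpa [hide] using hss x e
  have hne : ∀ x y : S, x ≠ y → x * y ≠ e := fun x y n he => n (by
    have := hss x y
    rw [he, hide] at this; exact this)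
  refine ⟨fun x => if x = e then 0 else 2, fun x => rfl, ?_⟩
  intro x y
  by_cases hx : x = e
  · simp [hx, hef, hid]
  by_cases hy : y = e
  · simp [hy, hfe, hide]
  by_cases hxy : x = y
  · subst hxy
    simp only [hxx, hx, if_false, if_true, (ht x hx).2]
    norm_num
    try norm_cast
  · simp only [hx, hy, hne x y hxy, if_false, hfh x y hx hy hxy, (ht x hx).1, (ht y hy).1]
    norm_num
    norm_cast
    rw [pow_two]
end

/-- (Proposition 6.8) (a) If `S` has exactly four elements, the
Steiner-like loop `L` is a right Bol loop iff the values of `h` commute pairwise, all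
`f(x,x)` are central in `A` and identity (∗) holds. (b) If `S` has more than four
elements, `L` is a right Bol loop with non-associative multiplication iff `S` is
associative and there is `t ∈ A` with `t⁴` central but `t²` not central such that
`h(x) = t` and `f(x,x) = t⁴` for all non-identity `x`. -/
theorem stmt16 {S : Type*} [Mul S] (e : S)
    (hid : ∀ x : S, e * x = x)
    (hcomm : ∀ x y : S, x * y = y * x)
    (hss : ∀ x y : S, x * (x * y) = y)
    {A : Type*} [Group A] (h : S → A) (f : S → S → A)
    (hfe : ∀ x : S, f x e = 1) (hef : ∀ x : S, f e x = 1)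
    (hfh : ∀ x y : S, x ≠ e → y ≠ e → x ≠ y → f x y = h x * h y) :
    (Nat.card S = 4 →
      ((∀ p q r : S × A,
          steinerMul f r (steinerMul f (steinerMul f p q) p) =
            steinerMul f (steinerMul f (steinerMul f r p) q) p) ↔
        ((∀ x y : S, x ≠ e → y ≠ e → h x * h y = h y * h x) ∧
          (∀ x : S, f x x ∈ Subgroup.center A) ∧
          (∀ x y : S, x ≠ e → y ≠ e → x ≠ y →
            h x * h y * h x * h (x * y) = f x x)))) ∧
    ((∃ a b c d g : S, a ≠ b ∧ a ≠ c ∧ a ≠ d ∧ a ≠ g ∧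
        b ≠ c ∧ b ≠ d ∧ b ≠ g ∧ c ≠ d ∧ c ≠ g ∧ d ≠ g) →
      (((∀ p q r : S × A,
          steinerMul f r (steinerMul f (steinerMul f p q) p) =
            steinerMul f (steinerMul f (steinerMul f r p) q) p) ∧
        ¬ (∀ p q r : S × A,
          steinerMul f (steinerMul f p q) r = steinerMul f p (steinerMul f q r))) ↔
        ((∀ x y z : S, x * y * z = x * (y * z)) ∧
          ∃ t : A, t ^ 4 ∈ Subgroup.center A ∧ t ^ 2 ∉ Subgroup.center A ∧
            ∀ x : S, x ≠ e → h x = t ∧ f x x = t ^ 4))) := by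
  rw [bol_iff e hid hcomm hss f]
  have hide : ∀ x : S, x * e = x := fun x => by rw [hcomm, hid]
  have hxx : ∀ x : S, x * x = e := fun x => by simpa [hide] using hss x e
  have hne : ∀ x y : S, x ≠ y → x * y ≠ e := fun x y n he => n (by
    have := hss x y
    rw [he, hide] at this; exact this)
  have hnx : ∀ x y : S, y ≠ e → x * y ≠ x := fun x y n he => n (by
    have := hss x y
    rw [he, hxx] at this; exact this.symm)
  refine ⟨?_, ?_⟩
  · intro h4
    constructor
    · rintro ⟨h0, h1, h2⟩
      exact bol_cons e hid hcomm hss h f hfe hef hfh h0 h1 h2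
    · rintro ⟨a1, a2, a3⟩
      exact four_cons e hid hcomm hss h f hfe hef hfh h4 a1 a2 a3
  · intro h5
    have big : ∀ u v w k : S, ∃ x, x ≠ u ∧ x ≠ v ∧ x ≠ w ∧ x ≠ k := by
      classical
      obtain ⟨a, b, c, d, g, hh⟩ := h5
      intro u v w k
      by_contra! hcon
      have c5 : ({a, b, c, d, g} : Finset S).card = 5 := by
        repeat rw [Finset.card_insert_of_notMem (by simp; grind)]
        simp
      have c4 : ({u, v, w, k} : Finset S).card ≤ 4 := Finset.card_le_four
      have hsub : ({a, b, c, d, g} : Finset S) ⊆ ({u, v, w, k} : Finset S) := by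
        intro x _
        have := hcon x
        simp only [Finset.mem_insert, Finset.mem_singleton]
        tauto
      have := Finset.card_le_card hsub
      omega
    obtain ⟨u0, hu0, -⟩ := big e e e e
    obtain ⟨u1, hu1, hu10, -⟩ := big e u0 e e
    constructor
    · rintro ⟨⟨h0, h1, h2⟩, hna⟩
      obtain ⟨cmm, hcen, hst⟩ := bol_cons e hid hcomm hss h f hfe hef hfh h0 h1 h2
      have hconst : ∀ u v : S, u ≠ e → v ≠ e → u ≠ v → h u = h v := by
        intro u v hu hv huv
        obtain ⟨x, hx, hxu, hxv, hxuv⟩ := big e u v (u * v)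
        have nuv := hne u v huv
        -- y = x * (u * v), z = v
        have hyx : x * (u * v) ≠ x := hnx _ _ nuv
        have hy : x * (u * v) ≠ e := hne _ _ hxuv
        have hyv : v ≠ x * (u * v) := by
          intro h'
          have : x = u := by
            have a1 : x * v = u * v := by rw [h', hss, ← h']
            rw [hcomm, hcomm u] at a1
            have := hss v x
            rw [a1, hss] at this
            exact this.symm
          exact hxu this
        have hvx : v * x ≠ e := hne _ _ (Ne.symm hxv)
        have hvxy : v * x ≠ x * (u * v) := by
          intro h'
          have a1 := hss x v
          rw [hcomm x v, h', hss] at a1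
          exact hnx v u hu (by rw [hcomm]; exact a1)
        have e1 : v * x * (x * (u * v)) = u := by
          rw [h0, hss, hcomm u, hss]
        have e2 : x * (x * (u * v)) = u * v := hss _ _
        have k1 := h2 x (x * (u * v)) v
        have k2 := h2 x e v
        rw [e1, e2, hfh _ _ hv hy hyv, hfh _ _ hu hx (Ne.symm hxu), hfh _ _ hvx hy hvxy,
          hfh _ _ hv hx (Ne.symm hxv), hfh _ _ nuv hx (Ne.symm hxuv),
          hfh _ _ hx hy (Ne.symm hyx)] at k1
        have k3 := hst x (x * (u * v)) hx hy (Ne.symm hyx)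
        have k4 := hst x v hx hv hxv
        rw [e2, ← k4, hcomm x v] at k3
        exact (const_aux _ _ _ _ _ _ (cmm _ _ hx hv) (cmm _ _ hx hy) (cmm _ _ hx nuv)
          (cmm _ _ hx hvx) (cmm _ _ hv hy) (cmm _ _ hv nuv) (cmm _ _ hv hvx) (cmm _ _ hy nuv)
          (cmm _ _ hy hvx) k1 k3).symm
      have hu : ∀ x, x ≠ e → h x = h u0 := by
        intro x hx
        by_cases hxu : x = u0
        · rw [hxu]
        · exact hconst x u0 hx hu0 hxu
      have hF : ∀ x, x ≠ e → f x x = h u0 ^ 4 := by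
        intro x hx
        obtain ⟨y, hy, hyx, -⟩ := big e x e e
        rw [← hst x y hx hy (Ne.symm hyx), hu x hx, hu y hy, hu _ (hne x y (Ne.symm hyx))]
        simp [pow_succ]
      have ht := fun x hx => And.intro (hu x hx) (hF x hx)
      refine ⟨h0, h u0, ?_, ?_, ht⟩
      · rw [← hF u0 hu0]; exact hcen u0
      · intro hc2
        apply hna
        obtain ⟨n, hn, hf⟩ := zpow_form e hid hcomm hss h f hfe hef hfh _ ht
        have hc : ∀ x y, ∀ k, k * f x y = f x y * k := by
          intro x y
          apply Subgroup.mem_center_iff.1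
          obtain ⟨m, hm⟩ : ∃ m : ℤ, n x + n y - n (x * y) = 2 * m := by
            simp only [hn]
            split_ifs
            exacts [⟨0, by norm_num⟩, ⟨-1, by norm_num⟩, ⟨1, by norm_num⟩, ⟨0, by norm_num⟩,
              ⟨1, by norm_num⟩, ⟨0, by norm_num⟩, ⟨2, by norm_num⟩, ⟨1, by norm_num⟩]
          rw [hf, hm, zpow_mul]
          apply Subgroup.zpow_mem
          exact_mod_cast hc2
        rintro ⟨x, ξ⟩ ⟨y, η⟩ ⟨z, ζ⟩
        simp only [steinerMul, Prod.mk.injEq]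
        refine ⟨h0 x y z, ?_⟩
        have key : f (x * y) z * f x y = f x (y * z) * f y z := by
          simp only [hf, ← zpow_add, h0]
          congr 1
          ring
        calc f (x * y) z * (f x y * ξ * η) * ζ = (f (x * y) z * f x y) * ξ * η * ζ := by group
          _ = f x (y * z) * (f y z * ξ) * η * ζ := by rw [key]; group
          _ = f x (y * z) * (ξ * f y z) * η * ζ := by rw [hc y z ξ]
          _ = _ := by group
    · rintro ⟨h0, t, ht4, ht2, ht⟩
      obtain ⟨n, hn, hf⟩ := zpow_form e hid hcomm hss h f hfe hef hfh t ht
      have hs2 : ∀ x y : S, x * y * x = y := fun x y => by rw [hcomm, hss]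
      refine ⟨⟨h0, ?_, ?_⟩, ?_⟩
      · intro x y
        apply Subgroup.mem_center_iff.1
        rw [hf, hf, ← zpow_add, hs2]
        have : n (x * y) + n x - n y + (n x + n y - n (x * y)) = 2 * n x := by ring
        rw [this, hn]
        split_ifs
        · simp
        · exact_mod_cast ht4
      · intro x y z
        have : z * x * y * x = z * y := by rw [h0 z x y, hcomm x y, h0, hcomm _ x, hcomm y, hss]
        simp only [hf, ← zpow_add, hs2, this]
        congr 1
        ring
      · intro hass
        apply ht2
        rw [Subgroup.mem_center_iff]
        intro k
        have h1 := congrArg Prod.snd (hass (u0, k) (u0, 1) (u1, 1))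
        have h2 := congrArg Prod.snd (hass (u0, 1) (u0, 1) (u1, 1))
        have h3 := hfh u0 u1 hu0 hu1 (Ne.symm hu10)
        rw [(ht u0 hu0).1, (ht u1 hu1).1] at h3
        simp only [steinerMul, mul_one, h3] at h1 h2
        rw [← mul_assoc, h2, mul_assoc, mul_assoc _ k] at h1
        have h4 := mul_left_cancel h1
        rw [pow_two]
        exact h4.symm
end

section
/- Let L be a Steiner-like loop determined by data (S, A, h, f), and let J(x,ξ) = (x, f(x,x)⁻¹·ξ⁻¹) be the left inverse map of L. Then L has the automorphic inverse property, i.e. J(p·q) = J(p)·J(q) for all p, q ∈ L, if and only if the group A is commutative and h(x)²·h(y)² = f(x,x)·f(y,y)·f(x·y, x·y)⁻¹ holds for all distinct x, y ∈ S ∖ {e}. -/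
/-- The (left) inverse map of the Steiner-like loop: `J(x,ξ) = (x, f(x,x)⁻¹·ξ⁻¹)`. -/
def steinerInv {S A : Type*} [Group A] (f : S → S → A) (p : S × A) : S × A :=
  (p.1, (f p.1 p.1)⁻¹ * p.2⁻¹)

theorem aip_aux {A : Type*} [CommGroup A] (a b u v z c s t : A) (hz : z = a * b) :
    c⁻¹ * (z * s * t)⁻¹ = z * (u⁻¹ * s⁻¹) * (v⁻¹ * t⁻¹) ↔ a ^ 2 * b ^ 2 = u * v * c⁻¹ := by
  subst hz
  have key : c⁻¹ * (a * b * s * t)⁻¹ * (a * b * (u⁻¹ * s⁻¹) * (v⁻¹ * t⁻¹))⁻¹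
      = (a ^ 2 * b ^ 2)⁻¹ * (u * v * c⁻¹) := by
    apply Additive.ofMul.injective
    simp only [ofMul_mul, ofMul_inv, ofMul_pow]
    abel
  rw [← mul_inv_eq_one, key, inv_mul_eq_one]

/-- (Proposition 6.9) A Steiner-like loop `L` has the automorphic inverse
property `J(p·q) = J(p)·J(q)` iff `A` is commutative and
`h(x)²h(y)² = f(x,x)·f(y,y)·f(x·y,x·y)⁻¹` holds for all distinct non-identity `x, y`. -/
theorem stmt17 {S : Type*} [Mul S] (e : S)
    (hid : ∀ x : S, e * x = x)
    (hcomm : ∀ x y : S, x * y = y * x)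
    (hss : ∀ x y : S, x * (x * y) = y)
    {A : Type*} [Group A] (h : S → A) (f : S → S → A)
    (hfe : ∀ x : S, f x e = 1) (hef : ∀ x : S, f e x = 1)
    (hfh : ∀ x y : S, x ≠ e → y ≠ e → x ≠ y → f x y = h x * h y) :
    (∀ p q : S × A,
        steinerInv f (steinerMul f p q) =
          steinerMul f (steinerInv f p) (steinerInv f q)) ↔
      ((∀ a b : A, a * b = b * a) ∧
        ∀ x y : S, x ≠ e → y ≠ e → x ≠ y →
          (h x) ^ 2 * (h y) ^ 2 = f x x * f y y * (f (x * y) (x * y))⁻¹) := by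
  constructor
  · intro H
    have hc : ∀ a b : A, a * b = b * a := by
      intro a b
      have h1 := congrArg Prod.snd (H (e, a⁻¹) (e, b⁻¹))
      simp only [steinerInv, steinerMul, hid, hfe] at h1
      simpa using h1.symm
    refine ⟨hc, fun x y hx hy hxy => ?_⟩
    have h1 := congrArg Prod.snd (H (x, 1) (y, 1))
    letI : CommGroup A := { (inferInstance : Group A) with mul_comm := hc }
    exact (aip_aux (h x) (h y) (f x x) (f y y) (f x y) _ 1 1 (hfh x y hx hy hxy)).1 h1
  · rintro ⟨hc, H⟩ ⟨x, s⟩ ⟨y, t⟩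
    letI : CommGroup A := { (inferInstance : Group A) with mul_comm := hc }
    refine Prod.ext rfl ?_
    change (f (x * y) (x * y))⁻¹ * (f x y * s * t)⁻¹
      = f x y * ((f x x)⁻¹ * s⁻¹) * ((f y y)⁻¹ * t⁻¹)
    by_cases hx : x = e
    · subst hx
      refine (aip_aux 1 1 _ _ _ _ s t (by rw [hef, one_mul])).2 ?_
      simp [hid, hef]
    by_cases hy : y = e
    · subst hy
      refine (aip_aux 1 1 _ _ _ _ s t (by rw [hfe, one_mul])).2 ?_
      simp [hcomm x, hid, hef]
    by_cases hxy : x = y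
    · subst hxy
      have hxx : x * x = e := by
        have := hss x e
        rwa [hcomm x e, hid] at this
      refine (aip_aux (f x x) 1 _ _ _ _ s t (mul_one _).symm).2 ?_
      rw [hxx, hef, one_pow, mul_one, inv_one, mul_one, pow_two]
    · exact (aip_aux (h x) (h y) _ _ _ _ s t (hfh x y hx hy hxy)).2 (H x y hx hy hxy)
end

section
/- Let L be a Steiner-like loop determined by data (S, A, h, f). Then L has the weak inverse property, i.e. for all p, q, r ∈ L, (p·q)·r = (e,1) implies p·(q·r) = (e,1), if and only if f(x,y) lies in the centre of A for all x, y ∈ S and there exists a fixed element s ∈ A such that f(x,x) = s·h(x) = h(x)·s for all x ∈ S ∖ {e}. -/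
/-- (Proposition 6.11) A Steiner-like loop `L` has the weak inverse
property (`(p·q)·r = (e,1)` implies `p·(q·r) = (e,1)`) iff all values `f(x,y)` are
central in `A` and there is a fixed `s ∈ A` with `f(x,x) = s·h(x) = h(x)·s` for all
non-identity `x`. -/
theorem stmt18 {S : Type*} [Mul S] (e : S)
    (hid : ∀ x : S, e * x = x)
    (hcomm : ∀ x y : S, x * y = y * x)
    (hss : ∀ x y : S, x * (x * y) = y)
    {A : Type*} [Group A] (h : S → A) (f : S → S → A)
    (hfe : ∀ x : S, f x e = 1) (hef : ∀ x : S, f e x = 1)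
    (hfh : ∀ x y : S, x ≠ e → y ≠ e → x ≠ y → f x y = h x * h y) :
    (∀ p q r : S × A,
        steinerMul f (steinerMul f p q) r = ((e, 1) : S × A) →
          steinerMul f p (steinerMul f q r) = ((e, 1) : S × A)) ↔
      ((∀ x y : S, f x y ∈ Subgroup.center A) ∧
        ∃ s : A, ∀ x : S, x ≠ e → f x x = s * h x ∧ f x x = h x * s) := by
  have hxe : ∀ x : S, x * e = x := fun x => by rw [hcomm, hid]
  have hxx : ∀ x : S, x * x = e := fun x => by
    have := hss x e
    rwa [hxe] at this
  have hyxy : ∀ x y : S, y * (x * y) = x := fun x y => by rw [hcomm x y, hss]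
  have hinv : ∀ x y : S, x * y = e → y = x := fun x y hxy => by
    have := hss x y
    rw [hxy, hxe] at this
    exact this.symm
  constructor
  · intro W
    have key : ∀ (x y : S) (ξ : A),
        f x x * ξ * f y (x * y) * ξ⁻¹ = f (x * y) (x * y) * f x y := by
      intro x y ξ
      have := W (x, ξ) (y, 1) (x * y, (f (x * y) (x * y) * f x y * ξ)⁻¹) (by
        simp only [steinerMul, Prod.mk.injEq]
        exact ⟨hxx _, by group⟩)
      simp only [steinerMul, Prod.mk.injEq, hyxy] at this
      have h2 := this.2
      have h3 : f x x * ξ * f y (x * y) * ξ⁻¹ * (f (x * y) (x * y) * f x y)⁻¹ = 1 := by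
        rw [← h2]; group
      exact mul_inv_eq_one.mp h3
    have cen : ∀ x y : S, f x y ∈ Subgroup.center A := by
      intro y z
      rw [Subgroup.mem_center_iff]
      intro ξ
      have h1 := key (y * z) y ξ
      have h2 := key (y * z) y 1
      have hz : y * z * y = z := by rw [hcomm, hss]
      rw [hz] at h1 h2
      rw [← h2] at h1
      simp only [mul_one, inv_one, mul_assoc] at h1
      have h3 := mul_left_cancel h1
      rw [← mul_assoc] at h3
      exact mul_inv_eq_iff_eq_mul.mp h3
    refine ⟨cen, ?_⟩
    have hc : ∀ x y : S, x ≠ e → y ≠ e → x ≠ y → h x * h y = h y * h x := by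
      intro x y hx hy hxy
      have h1 := Subgroup.mem_center_iff.mp (cen x y) (h x)
      rw [hfh x y hx hy hxy, mul_assoc] at h1
      exact mul_left_cancel h1
    by_cases hS : ∃ a : S, a ≠ e
    · obtain ⟨a, ha⟩ := hS
      have hs : ∀ x : S, x ≠ e → f x x * (h x)⁻¹ = f a a * (h a)⁻¹ := by
        intro x hx
        by_cases hxa : x = a
        · rw [hxa]
        have hye : x * a ≠ e := fun hh => hxa (hinv x a hh).symm
        have hya : x * a ≠ a := fun hh => hx (by
          have := hyxy x a
          rw [hh, hxx] at this
          exact this.symm)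
        have hyx : x ≠ x * a := fun hh => ha (by
          have := hss x a
          rw [← hh, hxx] at this
          exact this.symm)
        have k := key x (x * a) 1
        rw [hss] at k
        simp only [mul_one, inv_one] at k
        rw [hfh _ _ hye ha hya, hfh _ _ hx hye hyx, hc _ _ hye ha hya, ← mul_assoc,
          ← mul_assoc] at k
        have k2 := mul_right_cancel k
        rw [mul_inv_eq_iff_eq_mul]
        have k3 : f x x = f a a * h x * (h a)⁻¹ := by rw [← k2]; group
        rw [k3, mul_assoc, mul_assoc]
        congr 1
        have k4 := hc x a hx ha hxa
        rw [mul_inv_eq_iff_eq_mul, mul_assoc, k4]; group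
      refine ⟨f a a * (h a)⁻¹, fun x hx => ?_⟩
      rw [← hs x hx]
      refine ⟨by group, ?_⟩
      rw [← mul_assoc, Subgroup.mem_center_iff.mp (cen x x) (h x)]
      group
    · exact ⟨1, fun x hx => (hS ⟨x, hx⟩).elim⟩
  · rintro ⟨cen, s, hs⟩ ⟨x, ξ⟩ ⟨y, η⟩ ⟨z, ζ⟩ hw
    simp only [steinerMul, Prod.mk.injEq] at hw ⊢
    obtain ⟨h1, h2⟩ := hw
    have hz := hinv _ _ h1
    subst hz
    rw [hyxy]
    refine ⟨hxx x, ?_⟩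
    have hc : ∀ x y : S, x ≠ e → y ≠ e → x ≠ y → h x * h y = h y * h x := by
      intro x y hx hy hxy
      have h1 := Subgroup.mem_center_iff.mp (cen x y) (h x)
      rw [hfh x y hx hy hxy, mul_assoc] at h1
      exact mul_left_cancel h1
    have main : f x x * f y (x * y) = f (x * y) (x * y) * f x y := by
      by_cases hx : x = e
      · subst hx; simp [hid, hef]
      by_cases hy : y = e
      · subst hy; simp [hxe, hef, hfe]
      by_cases hxy : x = y
      · subst hxy; simp [hxx, hfe]
      have hze : x * y ≠ e := fun hh => hxy (hinv x y hh).symm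
      have hzy : y ≠ x * y := fun hh => hx (by
        have := hyxy x y
        rw [← hh, hxx] at this
        exact this.symm)
      have hzx : x ≠ x * y := fun hh => hy (by
        have := hss x y
        rw [← hh, hxx] at this
        exact this.symm)
      rw [hfh _ _ hy hze hzy, hfh _ _ hx hy hxy, (hs x hx).1, (hs _ hze).1,
        hc _ _ hy hze hzy, mul_assoc, mul_assoc, ← mul_assoc (h x), ← mul_assoc (h (x * y)),
        hc _ _ hx hze hzx]
    have c := Subgroup.mem_center_iff.mp (cen y (x * y)) ξ
    calc f x x * ξ * (f y (x * y) * η * ζ) = f x x * (ξ * f y (x * y)) * η * ζ := by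
          simp only [mul_assoc]
      _ = (f x x * f y (x * y)) * ξ * η * ζ := by rw [c]; simp only [mul_assoc]
      _ = f (x * y) (x * y) * (f x y * ξ * η) * ζ := by rw [main]; simp only [mul_assoc]
      _ = 1 := h2
end

section
/- Let L₁ and L₂ be Steiner-like loops on the same set S × A determined by data (S, A, h₁, f₁) and (S, A, h₂, f₂) respectively. Let α′ : S → S be a bijection with α′(e) = e and α′(x·y) = α′(x)·α′(y) for all x, y ∈ S (an automorphism of the Steiner loop S), let α″ : A → A be a group automorphism, and let ρ : S → A be a map with ρ(e) = 1 whose values all lie in the centre of A. Define β : S × A → S × A by β(x,ξ) = (α′(x), ρ(α′(x))·α″(ξ)). Then β is an isomorphism from L₁ onto L₂, i.e. β((x,ξ)·₁(y,η)) = β(x,ξ)·₂β(y,η) for all (x,ξ), (y,η), if and only if α″(f₁(x,x)) = ρ(α′(x))²·f₂(α′(x), α′(x)) for all x ∈ S and α″(h₁(x))·α″(h₁(y)) = ρ(α′(x·y))⁻¹·ρ(α′(x))·ρ(α′(y))·h₂(α′(x))·h₂(α′(y)) for all distinct x, y ∈ S ∖ {e}. -/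
/-- (Corollary 9.2) Given two Steiner-like loops `L₁`, `L₂` on `S × A`
with data `(h₁, f₁)` and `(h₂, f₂)`, an automorphism `α′` of the Steiner loop `S`, a
group automorphism `α″` of `A` and a map `ρ : S → A` with `ρ(e) = 1` and central values,
the map `β(x,ξ) = (α′(x), ρ(α′(x))·α″(ξ))` is an isomorphism of `L₁` onto `L₂` iff
`α″(f₁(x,x)) = ρ(α′(x))²·f₂(α′(x),α′(x))` for all `x ∈ S` and
`α″(h₁(x))·α″(h₁(y)) = ρ(α′(x·y))⁻¹·ρ(α′(x))·ρ(α′(y))·h₂(α′(x))·h₂(α′(y))` for all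
distinct non-identity `x, y`. -/
theorem stmt19 {S : Type*} [Mul S] (e : S)
    (hid : ∀ x : S, e * x = x)
    (hcomm : ∀ x y : S, x * y = y * x)
    (hss : ∀ x y : S, x * (x * y) = y)
    {A : Type*} [Group A]
    (h₁ h₂ : S → A) (f₁ f₂ : S → S → A)
    (hf₁e : ∀ x : S, f₁ x e = 1) (hef₁ : ∀ x : S, f₁ e x = 1)
    (hfh₁ : ∀ x y : S, x ≠ e → y ≠ e → x ≠ y → f₁ x y = h₁ x * h₁ y)
    (hf₂e : ∀ x : S, f₂ x e = 1) (hef₂ : ∀ x : S, f₂ e x = 1)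
    (hfh₂ : ∀ x y : S, x ≠ e → y ≠ e → x ≠ y → f₂ x y = h₂ x * h₂ y)
    (α' : S → S) (hbij : Function.Bijective α') (hαe : α' e = e)
    (hαmul : ∀ x y : S, α' (x * y) = α' x * α' y)
    (α'' : A →* A) (hα'' : Function.Bijective α'')
    (ρ : S → A) (hρe : ρ e = 1) (hρc : ∀ x : S, ρ x ∈ Subgroup.center A) :
    (∀ p q : S × A,
        (fun r : S × A => ((α' r.1, ρ (α' r.1) * α'' r.2) : S × A))
            (steinerMul f₁ p q) =
          steinerMul f₂
            ((α' p.1, ρ (α' p.1) * α'' p.2))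
            ((α' q.1, ρ (α' q.1) * α'' q.2))) ↔
      ((∀ x : S, α'' (f₁ x x) = (ρ (α' x)) ^ 2 * f₂ (α' x) (α' x)) ∧
        (∀ x y : S, x ≠ e → y ≠ e → x ≠ y →
          α'' (h₁ x) * α'' (h₁ y) =
            (ρ (α' (x * y)))⁻¹ * ρ (α' x) * ρ (α' y) * h₂ (α' x) * h₂ (α' y))) := by
  have c : ∀ (x : S) (a : A), a * ρ x = ρ x * a := fun x a =>
    Subgroup.mem_center_iff.1 (hρc x) a
  have hxx : ∀ x : S, x * x = e := by
    intro x
    have h := hss x e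
    rwa [hcomm x e, hid] at h
  have ne : ∀ x : S, x ≠ e → α' x ≠ e := fun x hx h =>
    hx (hbij.1 (h.trans hαe.symm))
  -- the homomorphism property reduces to an identity between the cocycles
  have key : (∀ p q : S × A,
        (fun r : S × A => ((α' r.1, ρ (α' r.1) * α'' r.2) : S × A))
            (steinerMul f₁ p q) =
          steinerMul f₂
            ((α' p.1, ρ (α' p.1) * α'' p.2))
            ((α' q.1, ρ (α' q.1) * α'' q.2))) ↔
      ∀ x y : S, ρ (α' (x * y)) * α'' (f₁ x y) =
        ρ (α' x) * ρ (α' y) * f₂ (α' x) (α' y) := by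
    constructor
    · intro h x y
      have h1 := congrArg Prod.snd (h (x, 1) (y, 1))
      simp only [steinerMul, mul_one, map_one] at h1
      rw [h1, c, c, ← mul_assoc, c]
    · rintro h ⟨x, ξ⟩ ⟨y, η⟩
      have h1 := h x y
      simp only [steinerMul, Prod.mk.injEq]
      refine ⟨hαmul x y, ?_⟩
      rw [map_mul, map_mul, ← mul_assoc, ← mul_assoc, h1]
      have e1 : f₂ (α' x) (α' y) * (ρ (α' x) * α'' ξ) * (ρ (α' y) * α'' η)
          = (f₂ (α' x) (α' y) * ρ (α' x)) * (α'' ξ * ρ (α' y)) * α'' η := by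
        group
      have e2 : ρ (α' x) * ρ (α' y) * f₂ (α' x) (α' y) * α'' ξ * α'' η
          = ρ (α' x) * (ρ (α' y) * f₂ (α' x) (α' y)) * α'' ξ * α'' η := by
        group
      rw [e1, e2, c, c, ← c (α' y) (f₂ _ _)]
      group
  rw [key]
  constructor
  · intro h
    refine ⟨fun x => ?_, fun x y hx hy hxy => ?_⟩
    · have h1 := h x x
      rwa [hxx, hαe, hρe, one_mul, ← sq] at h1
    · have h1 := h x y
      rw [hfh₁ x y hx hy hxy, map_mul,
        hfh₂ _ _ (ne x hx) (ne y hy) (fun h => hxy (hbij.1 h))] at h1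
      rw [eq_inv_mul_of_mul_eq h1]
      simp only [mul_assoc]
  · rintro ⟨hd, ho⟩ x y
    by_cases hx : x = e
    · subst hx
      simp [hid, hef₁, hef₂, hαe, hρe]
    by_cases hy : y = e
    · subst hy
      simp [hcomm x, hid, hf₁e, hf₂e, hαe, hρe]
    by_cases hxy : x = y
    · subst hxy
      rw [hxx, hαe, hρe, one_mul, ← sq, hd]
    · rw [hfh₁ x y hx hy hxy, map_mul,
        hfh₂ _ _ (ne x hx) (ne y hy) (fun h => hxy (hbij.1 h)), ho x y hx hy hxy]
      group
end
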